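/- Under Assumptions (A) and (B), with σ̃_n² := ∑_{i=0}^{p−1} E[Z̃_{i+1}²], the normalized sum σ̃_n^{−1} ∑_{i=0}^{p−1} Z̃_{i+1} converges in distribution to N(0,1) as n → ∞. -/

import Mathlib

open MeasureTheory ProbabilityTheory Matrix Filter Topology

noncomputable section

/-- The standard Gaussian measure on `ℝ^d` (modeled on `Fin d → ℝ`). -/
def gaussianPi (d : ℕ) : Measure (Fin d → ℝ) :=
  Measure.pi fun _ => gaussianReal 0 1

/-- The Euclidean norm on `Fin n → ℝ`. -/
def euclidNorm {n : ℕ} (x : Fin n → ℝ) : ℝ :=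
  Real.sqrt (∑ j, x j ^ 2)

/-- The uniform distribution on the unit sphere `S^{n-1} ⊆ ℝ^n`, realized as the law of a
normalized standard Gaussian vector. -/
def uniformSphere (n : ℕ) : Measure (Fin n → ℝ) :=
  (gaussianPi n).map fun x => (euclidNorm x)⁻¹ • x

/-- The joint law of `p` independent uniform random directions `u_1, …, u_p` on `S^{n-1}`. -/
def sphereLaw (n p : ℕ) : Measure (Fin p → Fin n → ℝ) :=
  Measure.pi fun _ => uniformSphere n

/-- The `(i+1)`-st sample vector `u_{i+1}` (junk value `0` if `i ≥ p`). -/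
def uVec {n p : ℕ} (ω : Fin p → Fin n → ℝ) (i : ℕ) : Fin n → ℝ :=
  if h : i < p then ω ⟨i, h⟩ else 0

/-- The matrix `B_{(i)} = (b_1, …, b_i)ᵀ` with rows `b_j = A u_j`. -/
def rowMat {n p : ℕ} (A : Matrix (Fin n) (Fin n) ℝ) (ω : Fin p → Fin n → ℝ) (i : ℕ) :
    Matrix (Fin i) (Fin n) ℝ :=
  Matrix.of fun k j => A.mulVec (uVec ω (k : ℕ)) j

/-- The projection matrix `P_i = I_n − B_{(i)}ᵀ (B_{(i)} B_{(i)}ᵀ)⁻¹ B_{(i)}` (with `P_0 = I_n`). -/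
def projMat {n p : ℕ} (A : Matrix (Fin n) (Fin n) ℝ) (ω : Fin p → Fin n → ℝ) (i : ℕ) :
    Matrix (Fin n) (Fin n) ℝ :=
  1 - (rowMat A ω i)ᵀ * (rowMat A ω i * (rowMat A ω i)ᵀ)⁻¹ * rowMat A ω i

/-- The entrywise expectation `E[P_i]` of the projection matrix `P_i`. -/
def meanProj (n p : ℕ) (A : Matrix (Fin n) (Fin n) ℝ) (i : ℕ) :
    Matrix (Fin n) (Fin n) ℝ :=
  Matrix.of fun k l => ∫ ω, projMat A ω i k l ∂(sphereLaw n p)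

/-- `T_i = tr(A² E[P_i])`. -/
def Tstat (n p : ℕ) (A : Matrix (Fin n) (Fin n) ℝ) (i : ℕ) : ℝ :=
  Matrix.trace (A * A * meanProj n p A i)

/-- `Q_i = A P_i A / T_i`. -/
def Qmat {n p : ℕ} (A : Matrix (Fin n) (Fin n) ℝ) (ω : Fin p → Fin n → ℝ) (i : ℕ) :
    Matrix (Fin n) (Fin n) ℝ :=
  (Tstat n p A i)⁻¹ • (A * projMat A ω i * A)

/-- `Z̃_{i+1} = n u_{i+1}ᵀ Q_i u_{i+1} − 1`. -/
def Ztil {n p : ℕ} (A : Matrix (Fin n) (Fin n) ℝ) (ω : Fin p → Fin n → ℝ) (i : ℕ) : ℝ :=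
  (n : ℝ) * (uVec ω i ⬝ᵥ (Qmat A ω i).mulVec (uVec ω i)) - 1

/-- The variance `Var(f) = E[(f − E f)²]` of a real random variable `f` under `μ`. -/
def varInt {α : Type*} [MeasurableSpace α] (μ : Measure α) (f : α → ℝ) : ℝ :=
  ∫ ω, (f ω - ∫ ω', f ω' ∂μ) ^ 2 ∂μ

end

open MeasureTheory ProbabilityTheory Matrix Filter Topology

instance instProbGaussianPi (n : ℕ) : IsProbabilityMeasure (gaussianPi n) := by
  unfold gaussianPi; infer_instance

theorem euclidNorm_eq {n : ℕ} (x : Fin n → ℝ) : euclidNorm x = ‖WithLp.toLp 2 x‖ := by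
  rw [EuclideanSpace.norm_eq]; simp [euclidNorm]

theorem measurable_euclidNorm {n : ℕ} : Measurable (euclidNorm (n := n)) := by
  unfold euclidNorm; fun_prop

theorem measurable_normalize {n : ℕ} :
    Measurable (fun x : Fin n → ℝ => (euclidNorm x)⁻¹ • x) :=
  (measurable_euclidNorm.inv).smul measurable_id

instance instProbSphere (n : ℕ) : IsProbabilityMeasure (uniformSphere n) := by
  unfold uniformSphere
  exact Measure.isProbabilityMeasure_map measurable_normalize.aemeasurable

instance instProbSphereLaw (n p : ℕ) : IsProbabilityMeasure (sphereLaw n p) := by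
  unfold sphereLaw; infer_instance

/-- rotation acting on plain functions -/
noncomputable def rotFun {n : ℕ} (e : EuclideanSpace ℝ (Fin n) ≃ₗᵢ[ℝ] EuclideanSpace ℝ (Fin n))
    (x : Fin n → ℝ) : Fin n → ℝ := WithLp.ofLp (e (WithLp.toLp 2 x))

theorem measurable_rotFun {n : ℕ}
    (e : EuclideanSpace ℝ (Fin n) ≃ₗᵢ[ℝ] EuclideanSpace ℝ (Fin n)) : Measurable (rotFun e) := by
  unfold rotFun; 
  have : Continuous (fun x : Fin n → ℝ => WithLp.ofLp (e (WithLp.toLp 2 x))) := by fun_prop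
  exact this.measurable

theorem gaussianPi_rot {n : ℕ} (e : EuclideanSpace ℝ (Fin n) ≃ₗᵢ[ℝ] EuclideanSpace ℝ (Fin n)) :
    (gaussianPi n).map (rotFun e) = gaussianPi n := by
  have h := stdGaussian_map (E := EuclideanSpace ℝ (Fin n)) e
  rw [← map_pi_eq_stdGaussian, Measure.map_map (by fun_prop) (by fun_prop)] at h
  have h2 := congrArg (fun m => Measure.map (WithLp.ofLp (p := 2)) m) h
  simp only at h2
  rw [Measure.map_map (by fun_prop) (by fun_prop), Measure.map_map (by fun_prop) (by fun_prop)] at h2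
  have h3 : (WithLp.ofLp (p := 2)) ∘ (WithLp.toLp 2) = (id : (Fin n → ℝ) → (Fin n → ℝ)) := by
    ext; simp
  rw [h3, Measure.map_id] at h2
  exact h2

theorem sphere_rot {n : ℕ} (e : EuclideanSpace ℝ (Fin n) ≃ₗᵢ[ℝ] EuclideanSpace ℝ (Fin n)) :
    (uniformSphere n).map (rotFun e) = uniformSphere n := by
  conv_rhs => rw [uniformSphere, ← gaussianPi_rot e]
  rw [uniformSphere, Measure.map_map (measurable_rotFun e) measurable_normalize,
    Measure.map_map measurable_normalize (measurable_rotFun e)]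
  congr 1
  ext x j
  simp [rotFun, euclidNorm_eq]

theorem sphere_integral {n : ℕ} {F : (Fin n → ℝ) → ℝ} (hF : Measurable F) :
    ∫ v, F v ∂(uniformSphere n) = ∫ x, F ((euclidNorm x)⁻¹ • x) ∂(gaussianPi n) := by
  rw [uniformSphere, integral_map measurable_normalize.aemeasurable hF.aestronglyMeasurable]

theorem sphere_rot_integral {n : ℕ} {R : (Fin n → ℝ) → (Fin n → ℝ)} (hR : Measurable R)
    (h : (uniformSphere n).map R = uniformSphere n) {F : (Fin n → ℝ) → ℝ} (hF : Measurable F) :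
    ∫ v, F (R v) ∂(uniformSphere n) = ∫ v, F v ∂(uniformSphere n) := by
  conv_rhs => rw [← h]
  rw [integral_map hR.aemeasurable hF.aestronglyMeasurable]

theorem diag_exists {n : ℕ} (M : Matrix (Fin n) (Fin n) ℝ) (hM : Mᵀ = M) :
    ∃ (l : Fin n → ℝ) (R : (Fin n → ℝ) → (Fin n → ℝ)), Measurable R ∧
      (uniformSphere n).map R = uniformSphere n ∧
      (∀ v, v ⬝ᵥ M.mulVec v = ∑ j, l j * (R v j) ^ 2) ∧ ∑ j, l j = M.trace ∧
      ∑ j, l j ^ 2 = (M * M).trace ∧ (∀ j, ∃ v, v ⬝ᵥ v = 1 ∧ l j = v ⬝ᵥ M.mulVec v) := by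
  have hH : M.IsHermitian := by
    rw [Matrix.IsHermitian, Matrix.conjTranspose_eq_transpose_of_trivial, hM]
  have hev : ∀ j, M *ᵥ WithLp.ofLp (hH.eigenvectorBasis j)
      = hH.eigenvalues j • WithLp.ofLp (hH.eigenvectorBasis j) := hH.mulVec_eigenvectorBasis
  have hdot : ∀ j (v : Fin n → ℝ), hH.eigenvectorBasis.repr (WithLp.toLp 2 v) j
      = WithLp.ofLp (hH.eigenvectorBasis j) ⬝ᵥ v := by
    intro j v
    rw [OrthonormalBasis.repr_apply_apply, EuclideanSpace.inner_eq_star_dotProduct]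
    simp [dotProduct_comm]
  have hsum : ∀ v : Fin n → ℝ, v = ∑ j, hH.eigenvectorBasis.repr (WithLp.toLp 2 v) j •
      WithLp.ofLp (hH.eigenvectorBasis j) := by
    intro v
    have := congrArg WithLp.ofLp (hH.eigenvectorBasis.sum_repr (WithLp.toLp 2 v))
    simpa using this.symm
  have hunit : ∀ j, WithLp.ofLp (hH.eigenvectorBasis j) ⬝ᵥ WithLp.ofLp (hH.eigenvectorBasis j)
      = 1 := by
    intro j
    rw [← hdot]; simp
  refine ⟨hH.eigenvalues, rotFun hH.eigenvectorBasis.repr, measurable_rotFun _, sphere_rot _,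
    ?_, ?_, ?_, ?_⟩
  · intro v
    have h1 : ∀ j, WithLp.ofLp (hH.eigenvectorBasis j) ⬝ᵥ M *ᵥ v =
        hH.eigenvalues j * hH.eigenvectorBasis.repr (WithLp.toLp 2 v) j := by
      intro j
      rw [dotProduct_mulVec, ← mulVec_transpose, hM, hev, smul_dotProduct, hdot, smul_eq_mul]
    have h2 := congrArg (fun z => z ⬝ᵥ M *ᵥ v) (hsum v)
    simp only at h2
    refine h2.trans ?_
    rw [sum_dotProduct]
    refine Finset.sum_congr rfl fun j _ => ?_
    rw [smul_dotProduct, h1, rotFun, smul_eq_mul]; ring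
  · have := hH.trace_eq_sum_eigenvalues
    simpa using this.symm
  · have h := hH.spectral_theorem
    have h2 : (M * M).trace = (diagonal (fun j => hH.eigenvalues j ^ 2)).trace := by
      conv_lhs => rw [h, ← map_mul]
      rw [Unitary.conjStarAlgAut_apply, trace_mul_cycle]
      simp [pow_two]
    rw [h2, trace_diagonal]
  · intro j
    refine ⟨_, hunit j, ?_⟩
    rw [hev, dotProduct_smul, hunit]; simp

open MeasureTheory ProbabilityTheory Matrix Filter Topology

theorem gaussianPi_coord_ne {n : ℕ} (j : Fin n) : ∀ᵐ x ∂(gaussianPi n), x j ≠ 0 := by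
  have h : MeasurePreserving (Function.eval j) (gaussianPi n) (gaussianReal 0 1) :=
    measurePreserving_eval (fun _ : Fin n => gaussianReal 0 1) j
  have : NullSingletonClass (gaussianReal 0 1) := nullSingletonClass_gaussianReal (by norm_num)
  have h0 : ∀ᵐ y ∂(gaussianReal 0 1), y ≠ 0 := by
    rw [ae_iff]; simp
  exact h.quasiMeasurePreserving.ae h0

theorem sphere_ae {n : ℕ} {P : (Fin n → ℝ) → Prop} (hP : MeasurableSet {v | P v})
    (h : ∀ᵐ x ∂(gaussianPi n), P ((euclidNorm x)⁻¹ • x)) : ∀ᵐ v ∂(uniformSphere n), P v := by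
  rw [uniformSphere, ae_map_iff measurable_normalize.aemeasurable hP]
  exact h

theorem euclidNorm_sq {n : ℕ} (x : Fin n → ℝ) : euclidNorm x ^ 2 = ∑ j, x j ^ 2 := by
  rw [euclidNorm, Real.sq_sqrt]; positivity

theorem euclidNorm_pos {n : ℕ} (x : Fin n → ℝ) (j : Fin n) (h : x j ≠ 0) : 0 < euclidNorm x := by
  rw [euclidNorm, Real.sqrt_pos]
  exact Finset.sum_pos' (fun i _ => sq_nonneg _) ⟨j, Finset.mem_univ _, by positivity⟩

theorem sphere_norm {n : ℕ} (hn : 0 < n) : ∀ᵐ v ∂(uniformSphere n), ∑ j, v j ^ 2 = 1 := by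
  refine sphere_ae ?_ ?_
  · exact measurableSet_eq_fun (by fun_prop) (by fun_prop)
  · filter_upwards [gaussianPi_coord_ne (⟨0, hn⟩ : Fin n)] with x hx
    have := euclidNorm_pos x _ hx
    simp only [Pi.smul_apply, smul_eq_mul, mul_pow, ← Finset.mul_sum, ← euclidNorm_sq]
    field_simp

theorem sphere_coord_ne {n : ℕ} (j : Fin n) : ∀ᵐ v ∂(uniformSphere n), v j ≠ 0 := by
  refine sphere_ae ?_ ?_
  · exact (measurableSet_eq_fun (by fun_prop) (by fun_prop)).compl
  · filter_upwards [gaussianPi_coord_ne j] with x hx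
    have := euclidNorm_pos x _ hx
    simp only [Pi.smul_apply, smul_eq_mul]
    positivity

theorem sphere_coord_le {n : ℕ} : ∀ᵐ v ∂(uniformSphere n), ∀ j, v j ^ 2 ≤ 1 := by
  rcases Nat.eq_zero_or_pos n with rfl | hn
  · exact Eventually.of_forall fun v j => j.elim0
  · filter_upwards [sphere_norm hn] with v hv j
    rw [← hv]
    exact Finset.single_le_sum (f := fun j => v j ^ 2) (fun i _ => sq_nonneg _) (Finset.mem_univ j)

theorem integrable_bdd {α : Type*} [MeasurableSpace α] {μ : Measure α} [IsFiniteMeasure μ]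
    {F : α → ℝ} (hF : Measurable F) (K : ℝ) (h : ∀ᵐ x ∂μ, |F x| ≤ K) : Integrable F μ :=
  Integrable.of_bound hF.aestronglyMeasurable K h

/-- planar reflection -/
noncomputable def refl2 {n : ℕ} (j k : Fin n) (c s : ℝ) (x : Fin n → ℝ) (i : Fin n) : ℝ :=
  if i = j then c * x j + s * x k else if i = k then s * x j - c * x k else x i

theorem refl2_exists {n : ℕ} (j k : Fin n) (hjk : j ≠ k) (c s : ℝ) (hcs : c ^ 2 + s ^ 2 = 1) :
    (uniformSphere n).map (refl2 j k c s) = uniformSphere n ∧ Measurable (refl2 j k c s) := by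
  let f : EuclideanSpace ℝ (Fin n) →ₗ[ℝ] EuclideanSpace ℝ (Fin n) :=
    { toFun := fun x => WithLp.toLp 2 (refl2 j k c s (WithLp.ofLp x))
      map_add' := by
        intro x y; ext i; simp only [refl2, PiLp.add_apply]; split_ifs <;> ring
      map_smul' := by
        intro a x; ext i; simp only [refl2, PiLp.smul_apply, smul_eq_mul, RingHom.id_apply]
        split_ifs <;> ring }
  have hnorm : ∀ x, ‖f x‖ = ‖x‖ := by
    intro x
    rw [EuclideanSpace.norm_eq, EuclideanSpace.norm_eq]
    congr 1
    rw [← sub_eq_zero, ← Finset.sum_sub_distrib,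
      ← Finset.sum_subset (Finset.subset_univ ({j, k} : Finset (Fin n)))]
    · rw [Finset.sum_pair hjk]
      simp only [f, LinearMap.coe_mk, AddHom.coe_mk, refl2, Real.norm_eq_abs, sq_abs, if_true,
        if_neg hjk.symm]
      linear_combination (x j ^ 2 + x k ^ 2) * hcs
    · intro i _ hi
      simp only [Finset.mem_insert, Finset.mem_singleton, not_or] at hi
      simp [f, refl2, hi.1, hi.2]
  let e := LinearIsometry.toLinearIsometryEquiv (⟨f, hnorm⟩ : EuclideanSpace ℝ (Fin n) →ₗᵢ[ℝ] _) rfl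
  have he : rotFun e = refl2 j k c s := by
    ext x i; simp [rotFun, e, f]
  rw [← he]
  exact ⟨sphere_rot e, measurable_rotFun e⟩

theorem sphere_int {n : ℕ} (j k : Fin n) :
    Integrable (fun v : Fin n → ℝ => v j ^ 2 * v k ^ 2) (uniformSphere n) := by
  refine integrable_bdd (by fun_prop) 1 ?_
  filter_upwards [sphere_coord_le] with v hv
  rw [abs_of_nonneg (by positivity)]
  exact mul_le_one₀ (hv j) (sq_nonneg _) (hv k)

theorem sphere_int2 {n : ℕ} (j : Fin n) :
    Integrable (fun v : Fin n → ℝ => v j ^ 2) (uniformSphere n) := by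
  refine integrable_bdd (by fun_prop) 1 ?_
  filter_upwards [sphere_coord_le] with v hv
  rw [abs_of_nonneg (by positivity)]
  exact hv j

theorem sphere_m2 {n : ℕ} (j : Fin n) : ∫ v, v j ^ 2 ∂(uniformSphere n) = 1 / n := by
  have hn : 0 < n := j.pos
  have hex : ∀ k, ∫ v, v k ^ 2 ∂(uniformSphere n) = ∫ v, v j ^ 2 ∂(uniformSphere n) := by
    intro k
    by_cases hkj : k = j
    · rw [hkj]
    obtain ⟨h1, h2⟩ := refl2_exists k j hkj 0 1 (by norm_num)
    rw [← sphere_rot_integral h2 h1 (F := fun v => v k ^ 2) (by fun_prop)]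
    simp [refl2]
  have hs : ∑ k, ∫ v, v k ^ 2 ∂(uniformSphere n) = 1 := by
    rw [← integral_finsetSum _ (fun k _ => sphere_int2 k), integral_congr_ae (sphere_norm hn)]
    simp
  simp only [hex, Finset.sum_const, Finset.card_univ, Fintype.card_fin, nsmul_eq_mul] at hs
  have : (n : ℝ) ≠ 0 := by positivity
  field_simp; linarith

theorem sphere_m4 {n : ℕ} (j k : Fin n) : ∫ v, v j ^ 2 * v k ^ 2 ∂(uniformSphere n)
      = (if j = k then 3 else 1) / (n * (n + 2)) := by
  have hn : 0 < n := j.pos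
  set a := ∫ v, v j ^ 2 * v j ^ 2 ∂(uniformSphere n) with ha
  have hex : ∀ k, ∫ v, v k ^ 2 * v k ^ 2 ∂(uniformSphere n) = a := by
    intro k
    by_cases hkj : k = j
    · rw [hkj]
    obtain ⟨h1, h2⟩ := refl2_exists k j hkj 0 1 (by norm_num)
    rw [← sphere_rot_integral h2 h1 (F := fun v => v k ^ 2 * v k ^ 2) (by fun_prop)]
    simp [refl2, ha]
  have hb : ∀ i k, i ≠ k → ∫ v, v i ^ 2 * v k ^ 2 ∂(uniformSphere n) = a / 3 := by
    intro i k hik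
    have h2 : (Real.sqrt 2)⁻¹ ^ 2 = 1 / 2 := by
      rw [inv_pow, Real.sq_sqrt (by norm_num)]; norm_num
    obtain ⟨h1, h3⟩ := refl2_exists i k hik (Real.sqrt 2)⁻¹ (Real.sqrt 2)⁻¹ (by rw [h2]; norm_num)
    have h4 := sphere_rot_integral h3 h1 (F := fun v => v i ^ 2 * v k ^ 2) (by fun_prop)
    have h5 : ∀ v : Fin n → ℝ, refl2 i k (Real.sqrt 2)⁻¹ (Real.sqrt 2)⁻¹ v i ^ 2 *
        refl2 i k (Real.sqrt 2)⁻¹ (Real.sqrt 2)⁻¹ v k ^ 2 =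
        (1/4) * (v i ^ 2 * v i ^ 2) + (1/4) * (v k ^ 2 * v k ^ 2) - (1/2) * (v i ^ 2 * v k ^ 2) := by
      intro v
      simp only [refl2, if_true, if_neg hik.symm]
      rw [← mul_add, ← mul_sub, mul_pow, mul_pow, h2]; ring
    simp only [h5] at h4
    have hi1 : Integrable (fun v : Fin n → ℝ => (1/4 : ℝ) * (v i ^ 2 * v i ^ 2) +
        (1/4) * (v k ^ 2 * v k ^ 2)) (uniformSphere n) :=
      ((sphere_int i i).const_mul _).add ((sphere_int k k).const_mul _)
    rw [integral_sub hi1 ((sphere_int i k).const_mul _), integral_add ((sphere_int i i).const_mul _)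
      ((sphere_int k k).const_mul _), integral_const_mul, integral_const_mul, integral_const_mul,
      hex, hex] at h4
    linarith
  have hs : ∑ i, ∑ k, ∫ v, v i ^ 2 * v k ^ 2 ∂(uniformSphere n) = 1 := by
    have : ∀ i, ∑ k, ∫ v, v i ^ 2 * v k ^ 2 ∂(uniformSphere n) = 
        ∫ v, v i ^ 2 ∂(uniformSphere n) := by
      intro i
      rw [← integral_finsetSum _ (fun k _ => sphere_int i k)]
      refine integral_congr_ae ?_
      filter_upwards [sphere_norm hn] with v hv
      rw [← Finset.mul_sum, hv, mul_one]
    simp only [this, sphere_m2]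
    have : (n : ℝ) ≠ 0 := by positivity
    simp; field_simp
  have hval : ∀ i k, ∫ v, v i ^ 2 * v k ^ 2 ∂(uniformSphere n) =
      a / 3 + (if i = k then 2 * a / 3 else 0) := by
    intro i k
    by_cases h : i = k
    · subst h; rw [hex]; simp; ring
    · rw [hb i k h]; simp [h]
  simp only [hval, Finset.sum_add_distrib, Finset.sum_const, Finset.card_univ, Fintype.card_fin,
    nsmul_eq_mul, Finset.sum_ite_eq, Finset.mem_univ, if_true] at hs
  have hn' : (n : ℝ) > 0 := by positivity
  have ha3 : a = 3 / (n * (n + 2)) := by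
    field_simp
    linarith
  rw [hval]
  by_cases h : j = k
  · simp only [h, if_true, ha3]; field_simp; ring
  · simp only [h, if_false, ha3]; field_simp; ring

theorem quad_diag_m1 {n : ℕ} (l : Fin n → ℝ) :
    ∫ v, ∑ j, l j * v j ^ 2 ∂(uniformSphere n) = (∑ j, l j) / n := by
  rw [integral_finsetSum _ (fun j _ => (sphere_int2 j).const_mul _)]
  simp only [integral_const_mul, sphere_m2, ← Finset.sum_mul]
  ring

theorem quad_diag_m2 {n : ℕ} (l : Fin n → ℝ) :
    ∫ v, (∑ j, l j * v j ^ 2) ^ 2 ∂(uniformSphere n)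
      = (2 * ∑ j, l j ^ 2 + (∑ j, l j) ^ 2) / (n * (n + 2)) := by
  have : ∀ v : Fin n → ℝ, (∑ j, l j * v j ^ 2) ^ 2 =
      ∑ j, ∑ k, (l j * l k) * (v j ^ 2 * v k ^ 2) := by
    intro v
    rw [pow_two, Finset.sum_mul_sum]
    refine Finset.sum_congr rfl fun j _ => Finset.sum_congr rfl fun k _ => by ring
  simp only [this]
  rw [integral_finsetSum _ (fun j _ => integrable_finsetSum _ fun k _ =>
    (sphere_int j k).const_mul _)]
  have h2 : ∀ j, ∫ v, ∑ k, (l j * l k) * (v j ^ 2 * v k ^ 2) ∂(uniformSphere n) =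
      (2 * l j ^ 2 + l j * ∑ k, l k) / (n * (n + 2)) := by
    intro j
    rw [integral_finsetSum _ (fun k _ => (sphere_int j k).const_mul _)]
    simp only [integral_const_mul, sphere_m4]
    have : ∀ k, l j * l k * ((if j = k then (3:ℝ) else 1) / (n * (n + 2))) =
       (l j * l k + (if j = k then 2 * l j * l k else 0)) / (n * (n + 2)) := by
      intro k; split_ifs <;> ring
    simp only [this, ← Finset.sum_div, Finset.sum_add_distrib, Finset.sum_ite_eq, Finset.mem_univ,
      if_true, ← Finset.mul_sum]
    ring
  simp only [h2, ← Finset.sum_div, Finset.sum_add_distrib, ← Finset.mul_sum, ← Finset.sum_mul]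
  ring

open MeasureTheory ProbabilityTheory Matrix Filter Topology

theorem indep_sum4 {Ω ι : Type*} [MeasurableSpace Ω] {μ : Measure Ω} [IsProbabilityMeasure μ]
    [DecidableEq ι] (ξ : ι → Ω → ℝ) (hind : iIndepFun ξ μ) (hmeas : ∀ i, Measurable (ξ i))
    (hIntg : ∀ i (k : ℕ), k ≤ 4 → Integrable (fun ω => ξ i ω ^ k) μ)
    (h0 : ∀ i, ∫ ω, ξ i ω ∂μ = 0) (k2 k4 : ℝ) (h2 : ∀ i, ∫ ω, ξ i ω ^ 2 ∂μ = k2)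
    (h4 : ∀ i, ∫ ω, ξ i ω ^ 4 ∂μ = k4) (m : ι → ℝ) (s : Finset ι) :
    (∀ k : ℕ, k ≤ 4 → Integrable (fun ω => (∑ i ∈ s, m i * ξ i ω) ^ k) μ) ∧
    ∫ ω, (∑ i ∈ s, m i * ξ i ω) ∂μ = 0 ∧
    ∫ ω, (∑ i ∈ s, m i * ξ i ω) ^ 2 ∂μ = k2 * ∑ i ∈ s, m i ^ 2 ∧
    ∫ ω, (∑ i ∈ s, m i * ξ i ω) ^ 4 ∂μ ≤ (3 * k2 ^ 2 + k4) * (∑ i ∈ s, m i ^ 2) ^ 2 := by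
  induction s using Finset.induction_on with
  | empty =>
    simp
  | insert a s ha ih =>
    obtain ⟨ihI, ih1, ih2, ih4⟩ := ih
    set S : Ω → ℝ := fun ω => ∑ i ∈ s, m i * ξ i ω with hS
    have ih2' : ∫ ω, S ω ^ 2 ∂μ = k2 * ∑ i ∈ s, m i ^ 2 := ih2
    have ih4' : ∫ ω, S ω ^ 4 ∂μ ≤ (3 * k2 ^ 2 + k4) * (∑ i ∈ s, m i ^ 2) ^ 2 := ih4
    have hSm : Measurable S := Finset.measurable_sum _ fun i _ => (hmeas i).const_mul _
    have hindep : IndepFun S (ξ a) μ := by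
      have hi3 := hind.indepFun_finset s {a} (by simpa using ha) hmeas
      have hg : Measurable (fun z : (s → ℝ) => ∑ i : s, m i * z i) := by fun_prop
      have hg2 : Measurable (fun z : (({a} : Finset ι) → ℝ) => z ⟨a, by simp⟩) := by fun_prop
      have h5 := hi3.comp hg hg2
      convert h5 using 1
      ext ω
      simp only [hS, Function.comp]
      rw [← Finset.sum_coe_sort s (fun i => m i * ξ i ω)]
      rfl
    have hjk : ∀ j k : ℕ, IndepFun (fun ω => S ω ^ j) (fun ω => ξ a ω ^ k) μ := fun j k =>
      hindep.comp (φ := fun x => x ^ j) (ψ := fun x => x ^ k) (by fun_prop) (by fun_prop)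
    have hIjk : ∀ j k : ℕ, j ≤ 4 → k ≤ 4 → Integrable (fun ω => S ω ^ j * ξ a ω ^ k) μ :=
      fun j k hj hk => (hjk j k).integrable_mul (ihI j hj) (hIntg a k hk)
    have hEjk : ∀ j k : ℕ, ∫ ω, S ω ^ j * ξ a ω ^ k ∂μ
        = (∫ ω, S ω ^ j ∂μ) * ∫ ω, ξ a ω ^ k ∂μ := fun j k =>
      (hjk j k).integral_fun_mul_eq_mul_integral (hSm.pow_const j).aestronglyMeasurable
        ((hmeas a).pow_const k).aestronglyMeasurable
    have hsum : ∀ ω, ∑ i ∈ insert a s, m i * ξ i ω = m a * ξ a ω + S ω := by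
      intro ω; rw [Finset.sum_insert ha]
    have hexp : ∀ k : ℕ, ∀ ω, (∑ i ∈ insert a s, m i * ξ i ω) ^ k =
        ∑ j ∈ Finset.range (k + 1), (m a ^ j * (k.choose j : ℝ)) * (S ω ^ (k - j) * ξ a ω ^ j) := by
      intro k ω
      rw [hsum, add_pow]
      refine Finset.sum_congr rfl fun j _ => ?_
      rw [mul_pow]; ring
    have hE : ∀ k : ℕ, k ≤ 4 → ∫ ω, (∑ i ∈ insert a s, m i * ξ i ω) ^ k ∂μ =
        ∑ j ∈ Finset.range (k + 1), (m a ^ j * (k.choose j : ℝ)) *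
          ((∫ ω, S ω ^ (k - j) ∂μ) * ∫ ω, ξ a ω ^ j ∂μ) := by
      intro k hk
      simp only [hexp]
      rw [integral_finsetSum]
      · simp only [integral_const_mul, hEjk]
      · intro j hj
        have : j ≤ k := by simpa [Nat.lt_succ_iff] using hj
        exact (hIjk _ _ (by omega) (by omega)).const_mul _
    refine ⟨?_, ?_, ?_, ?_⟩
    · intro k hk
      simp only [hexp]
      refine integrable_finsetSum _ fun j hj => ?_
      have : j ≤ k := by simpa [Nat.lt_succ_iff] using hj
      exact (hIjk _ _ (by omega) (by omega)).const_mul _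
    · have := hE 1 (by norm_num)
      simpa [Finset.sum_range_succ, ih1, h0] using this
    · rw [hE 2 (by norm_num), Finset.sum_insert ha]
      simp [Finset.sum_range_succ, ih1, h0, ih2', h2]; ring
    · rw [hE 4 le_rfl, Finset.sum_insert ha]
      have hk2 : 0 ≤ k2 := by rw [← h2 a]; exact integral_nonneg fun _ => sq_nonneg _
      have hk4 : 0 ≤ k4 := by rw [← h4 a]; exact integral_nonneg fun _ => by positivity
      have hq : 0 ≤ ∑ i ∈ s, m i ^ 2 := Finset.sum_nonneg fun _ _ => sq_nonneg _
      have hc3 : (Nat.choose 4 3 : ℝ) = 4 := by norm_num [Nat.choose]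
      have hc2 : (Nat.choose 4 2 : ℝ) = 6 := by norm_num [Nat.choose]
      simp [Finset.sum_range_succ, ih1, h0, ih2', h2, h4, hc2]
      nlinarith [ih4', mul_nonneg hk4 (mul_nonneg hq (sq_nonneg (m a))), sq_nonneg (m a ^ 2),
        mul_nonneg (sq_nonneg k2) (sq_nonneg (m a ^ 2)), mul_nonneg hk4 (sq_nonneg (m a ^ 2))]

theorem gauss_pow_int (k : ℕ) : Integrable (fun x : ℝ => (x ^ 2 - 1) ^ k) (gaussianReal 0 1) := by
  have h : ∀ j : ℕ, Integrable (fun x : ℝ => x ^ j) (gaussianReal 0 1) := by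
    intro j
    have h2 : MemLp (fun x : ℝ => x) (j : ENNReal) (gaussianReal 0 1) := by
      have := memLp_id_gaussianReal (μ := 0) (v := 1) (j : NNReal)
      exact_mod_cast this
    refine Integrable.mono h2.integrable_norm_pow' (by fun_prop) (by simp)
  simp only [sub_eq_add_neg, add_pow]
  refine integrable_finsetSum _ fun j _ => ?_
  simp only [← pow_mul, mul_assoc]
  exact (h _).mul_const _

theorem gauss_m2 : ∫ x, (x ^ 2 - 1 : ℝ) ∂(gaussianReal 0 1) = 0 := by
  have h := variance_fun_id_gaussianReal (μ := 0) (v := 1)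
  rw [variance_eq_integral (by fun_prop)] at h
  simp only [integral_id_gaussianReal, sub_zero] at h
  have h1 := gauss_pow_int 1
  simp only [pow_one] at h1
  have h2 : Integrable (fun x : ℝ => x ^ 2) (gaussianReal 0 1) := by
    have := h1.add (integrable_const (1:ℝ))
    refine this.congr (Eventually.of_forall fun x => ?_)
    simp
  rw [integral_sub h2 (integrable_const _), h]; simp

/-- universal constant of the Gaussian fourth moment bound -/
noncomputable def gK : ℝ := 3 * (∫ x, (x ^ 2 - 1 : ℝ) ^ 2 ∂(gaussianReal 0 1)) ^ 2 +
  ∫ x, (x ^ 2 - 1 : ℝ) ^ 4 ∂(gaussianReal 0 1)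

theorem gK_nonneg : 0 ≤ gK := by
  unfold gK
  have : 0 ≤ ∫ x, (x ^ 2 - 1 : ℝ) ^ 4 ∂(gaussianReal 0 1) := integral_nonneg fun _ => by positivity
  positivity

theorem gaussianPi_sum4 {n : ℕ} (m : Fin n → ℝ) :
    Integrable (fun x => (∑ i, m i * (x i ^ 2 - 1)) ^ 4) (gaussianPi n) ∧
    ∫ x, (∑ i, m i * (x i ^ 2 - 1)) ^ 4 ∂(gaussianPi n) ≤ gK * (∑ i, m i ^ 2) ^ 2 := by
  have hmp : ∀ i, MeasurePreserving (Function.eval i) (gaussianPi n) (gaussianReal 0 1) := fun i =>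
    measurePreserving_eval (fun _ : Fin n => gaussianReal 0 1) i
  have hind : iIndepFun (fun (i : Fin n) (x : Fin n → ℝ) => x i ^ 2 - 1) (gaussianPi n) :=
    iIndepFun_pi (μ := fun _ : Fin n => gaussianReal 0 1) (X := fun _ (x : ℝ) => x ^ 2 - 1)
      (fun i => by fun_prop)
  have hE : ∀ (i : Fin n) (k : ℕ), ∫ x : Fin n → ℝ, (x i ^ 2 - 1) ^ k ∂(gaussianPi n) =
      ∫ x, (x ^ 2 - 1 : ℝ) ^ k ∂(gaussianReal 0 1) := by
    intro i k
    rw [← (hmp i).map_eq, integral_map (hmp i).measurable.aemeasurable (by fun_prop)]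
  have := indep_sum4 (fun (i : Fin n) (x : Fin n → ℝ) => x i ^ 2 - 1) hind (fun i => by fun_prop)
    (fun i k _ => (hmp i).integrable_comp_of_integrable (gauss_pow_int k))
    (fun i => by simpa [gauss_m2] using hE i 1) _ _ (fun i => hE i 2) (fun i => hE i 4) m
    Finset.univ
  exact ⟨this.1 4 le_rfl, this.2.2.2⟩

theorem sphere_fourth {n : ℕ} (hn : 0 < n) (m : Fin n → ℝ) (hm : ∑ j, m j = 0) (κ : ℝ)
    (hκ : ∀ j, |m j| ≤ κ) :
    ∫ v, (n * ∑ j, m j * v j ^ 2) ^ 4 ∂(uniformSphere n) ≤ 16 * gK * κ ^ 4 * n ^ 2 := by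
  have hκ0 : 0 ≤ κ := (abs_nonneg _).trans (hκ ⟨0, hn⟩)
  have hn' : (0:ℝ) < n := by exact_mod_cast hn
  rw [sphere_integral (by fun_prop)]
  obtain ⟨hI1, hB1⟩ := gaussianPi_sum4 m
  obtain ⟨hI2, hB2⟩ := gaussianPi_sum4 (fun _ : Fin n => (1:ℝ))
  have hB1' : gK * (∑ i, m i ^ 2) ^ 2 ≤ gK * (n * κ ^ 2) ^ 2 := by
    refine mul_le_mul_of_nonneg_left ?_ gK_nonneg
    refine pow_le_pow_left₀ (Finset.sum_nonneg fun _ _ => sq_nonneg _) ?_ 2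
    calc ∑ i, m i ^ 2 ≤ ∑ i : Fin n, κ ^ 2 :=
          Finset.sum_le_sum fun i _ => sq_le_sq' (by linarith [neg_le_of_abs_le (hκ i)])
            (le_of_abs_le (hκ i))
      _ = n * κ ^ 2 := by simp
  have hpt : ∀ᵐ x ∂(gaussianPi n), (n * ∑ j, m j * ((euclidNorm x)⁻¹ • x) j ^ 2) ^ 4 ≤
      8 * (∑ i, m i * (x i ^ 2 - 1)) ^ 4 + 8 * κ ^ 4 * (∑ i, (1:ℝ) * (x i ^ 2 - 1)) ^ 4 := by
    filter_upwards [gaussianPi_coord_ne (⟨0, hn⟩ : Fin n)] with x hx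
    have hpos := euclidNorm_pos x _ hx
    have hsq := euclidNorm_sq x
    set S := ∑ j, x j ^ 2 with hS
    set G := ∑ i, m i * (x i ^ 2 - 1) with hG
    have hGe : G = ∑ i, m i * x i ^ 2 := by
      simp only [hG, mul_sub, Finset.sum_sub_distrib, mul_one, hm, sub_zero]
    have h1 : ∑ i, (1:ℝ) * (x i ^ 2 - 1) = S - n := by simp [hS]
    have hSpos : 0 < S := by rw [← hsq]; positivity
    have h2 : ∑ j, m j * ((euclidNorm x)⁻¹ • x) j ^ 2 = G / S := by
      rw [hGe, ← hsq, Finset.sum_div]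
      refine Finset.sum_congr rfl fun j _ => ?_
      simp only [Pi.smul_apply, smul_eq_mul]; field_simp
    rw [h1, h2]
    have hGS : |G / S| ≤ κ := by
      rw [abs_div, abs_of_pos hSpos, div_le_iff₀ hSpos, hGe, hS, Finset.mul_sum]
      refine (Finset.abs_sum_le_sum_abs _ _).trans (Finset.sum_le_sum fun i _ => ?_)
      rw [abs_mul, abs_of_nonneg (sq_nonneg (x i))]
      exact mul_le_mul_of_nonneg_right (hκ i) (sq_nonneg _)
    set W := G / S with hW
    have hWG : n * W = G - (S - n) * W := by rw [hW]; field_simp; ring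
    have h3 : (n * W) ^ 4 ≤ 8 * G ^ 4 + 8 * ((S - n) * W) ^ 4 := by
      rw [hWG]
      set b := (S - n) * W
      nlinarith [sq_nonneg (G ^ 2 - b ^ 2), sq_nonneg (G + b), sq_nonneg (G - b),
        sq_nonneg ((G + b) ^ 2), sq_nonneg (G * b), mul_nonneg (sq_nonneg (G+b)) (sq_nonneg (G-b)),
        mul_nonneg (sq_nonneg (G+b)) (sq_nonneg G), mul_nonneg (sq_nonneg (G+b)) (sq_nonneg b)]
    have h4 : W ^ 4 ≤ κ ^ 4 := by
      have := pow_le_pow_left₀ (abs_nonneg W) hGS 4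
      rwa [← abs_pow, abs_of_nonneg (by positivity)] at this
    have h5 : ((S - n) * W) ^ 4 ≤ κ ^ 4 * (S - n) ^ 4 := by
      rw [mul_pow, mul_comm]
      exact mul_le_mul_of_nonneg_right h4 (by positivity)
    linarith
  have hIr : Integrable (fun x => 8 * (∑ i, m i * (x i ^ 2 - 1)) ^ 4 +
      8 * κ ^ 4 * (∑ i, (1:ℝ) * (x i ^ 2 - 1)) ^ 4) (gaussianPi n) :=
    (hI1.const_mul _).add (hI2.const_mul _)
  have hmono := integral_mono_of_nonneg (μ := gaussianPi n)
    (f := fun x => (n * ∑ j, m j * ((euclidNorm x)⁻¹ • x) j ^ 2) ^ 4)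
    (Eventually.of_forall fun x => by positivity) hIr hpt
  refine hmono.trans ?_
  rw [integral_add (hI1.const_mul _) (hI2.const_mul _), integral_const_mul, integral_const_mul]
  simp only [one_pow, Finset.sum_const, Finset.card_univ, Fintype.card_fin, nsmul_eq_mul,
    mul_one] at hB2
  have hk : 0 ≤ 8 * κ ^ 4 := by positivity
  nlinarith [mul_le_mul_of_nonneg_left hB2 hk, hB1, hB1']

open MeasureTheory ProbabilityTheory Matrix Filter Topology

/-- quadratic form -/
def qf {n : ℕ} (M : Matrix (Fin n) (Fin n) ℝ) (v : Fin n → ℝ) : ℝ := v ⬝ᵥ M.mulVec v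

theorem qf_eq {n : ℕ} (M : Matrix (Fin n) (Fin n) ℝ) (v : Fin n → ℝ) :
    qf M v = ∑ j, v j * ∑ k, M j k * v k := rfl

theorem measurable_qf {n : ℕ} (M : Matrix (Fin n) (Fin n) ℝ) : Measurable (qf M) := by
  simp only [funext (qf_eq M)]; fun_prop

theorem sphere_qf_bdd {n : ℕ} (M : Matrix (Fin n) (Fin n) ℝ) :
    ∀ᵐ v ∂(uniformSphere n), |qf M v| ≤ ∑ j, ∑ k, |M j k| := by
  filter_upwards [sphere_coord_le] with v hv
  rw [qf_eq]
  have hv1 : ∀ j, |v j| ≤ 1 := fun j => by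
    have := hv j
    rwa [sq_le_one_iff_abs_le_one] at this
  refine (Finset.abs_sum_le_sum_abs _ _).trans (Finset.sum_le_sum fun j _ => ?_)
  rw [abs_mul]
  refine (mul_le_of_le_one_left (abs_nonneg _) (hv1 j)).trans ?_
  refine (Finset.abs_sum_le_sum_abs _ _).trans (Finset.sum_le_sum fun k _ => ?_)
  rw [abs_mul]
  exact mul_le_of_le_one_right (abs_nonneg _) (hv1 k)

theorem sphere_qf_int {n : ℕ} (M : Matrix (Fin n) (Fin n) ℝ) :
    Integrable (fun v => n * qf M v) (uniformSphere n) :=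
  (integrable_bdd (measurable_qf M) _ (sphere_qf_bdd M)).const_mul _

theorem sphere_qf_int2 {n : ℕ} (M : Matrix (Fin n) (Fin n) ℝ) :
    Integrable (fun v => (n * qf M v) ^ 2) (uniformSphere n) := by
  refine integrable_bdd (((measurable_qf M).const_mul _).pow_const 2) 
    ((n * ∑ j, ∑ k, |M j k|) ^ 2) ?_
  filter_upwards [sphere_qf_bdd M] with v hv
  rw [abs_pow, abs_mul, Nat.abs_cast]
  gcongr

theorem sphere_qf_m1 {n : ℕ} (hn : 0 < n) (M : Matrix (Fin n) (Fin n) ℝ) (hM : Mᵀ = M) :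
    ∫ v, n * qf M v ∂(uniformSphere n) = M.trace := by
  obtain ⟨l, R, hR, hRm, hq, h1, h2, h3⟩ := diag_exists M hM
  have hn' : (0:ℝ) < n := by exact_mod_cast hn
  rw [integral_const_mul]
  simp only [qf, hq]
  rw [sphere_rot_integral hR hRm (F := fun v => ∑ j, l j * v j ^ 2) (by fun_prop), quad_diag_m1, h1]
  field_simp

theorem sphere_qf_m2 {n : ℕ} (hn : 0 < n) (M : Matrix (Fin n) (Fin n) ℝ) (hM : Mᵀ = M) :
    ∫ v, (n * qf M v) ^ 2 ∂(uniformSphere n)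
      = n * (2 * (M * M).trace + M.trace ^ 2) / (n + 2) := by
  obtain ⟨l, R, hR, hRm, hq, h1, h2, h3⟩ := diag_exists M hM
  have hn' : (0:ℝ) < n := by exact_mod_cast hn
  simp only [mul_pow]
  rw [integral_const_mul]
  simp only [qf, hq]
  rw [sphere_rot_integral hR hRm (F := fun v => (∑ j, l j * v j ^ 2) ^ 2) (by fun_prop),
    quad_diag_m2, h1, h2]
  field_simp

theorem sphere_qf_cint {n : ℕ} (M : Matrix (Fin n) (Fin n) ℝ) (c : ℝ) :
    Integrable (fun v => (n * qf M v - c) ^ 2) (uniformSphere n) := by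
  have : (fun v => (n * qf M v - c) ^ 2) = 
      fun v => ((n * qf M v) ^ 2 - (2 * c) * (n * qf M v)) + c ^ 2 := by
    ext v; ring
  rw [this]
  exact ((sphere_qf_int2 M).sub ((sphere_qf_int M).const_mul _)).add (integrable_const _)

theorem sphere_qf_c {n : ℕ} (hn : 0 < n) (M : Matrix (Fin n) (Fin n) ℝ) (hM : Mᵀ = M) (c : ℝ) :
    ∫ v, (n * qf M v - c) ^ 2 ∂(uniformSphere n)
      = (2 * n * (M * M).trace - 2 * M.trace ^ 2) / (n + 2) + (M.trace - c) ^ 2 := by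
  have : (fun v => (n * qf M v - c) ^ 2) = 
      fun v => ((n * qf M v) ^ 2 - (2 * c) * (n * qf M v)) + c ^ 2 := by
    ext v; ring
  have hi : Integrable (fun v => (n * qf M v) ^ 2 - (2 * c) * (n * qf M v)) (uniformSphere n) :=
    (sphere_qf_int2 M).sub ((sphere_qf_int M).const_mul _)
  rw [this, integral_add hi (integrable_const _), integral_sub (sphere_qf_int2 M)
    ((sphere_qf_int M).const_mul _), integral_const_mul, sphere_qf_m1 hn M hM, sphere_qf_m2 hn M hM]
  have hn' : (0:ℝ) < n := by exact_mod_cast hn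
  simp
  field_simp
  ring

theorem sphere_qf_m4 {n : ℕ} (hn : 0 < n) (M : Matrix (Fin n) (Fin n) ℝ) (hM : Mᵀ = M) (C : ℝ)
    (h0 : ∀ v, 0 ≤ qf M v) (hC : ∀ v, qf M v ≤ C * (v ⬝ᵥ v)) :
    ∫ v, (n * qf M v - M.trace) ^ 4 ∂(uniformSphere n) ≤ 16 * gK * C ^ 4 * n ^ 2 := by
  obtain ⟨l, R, hR, hRm, hq, h1, h2, h3⟩ := diag_exists M hM
  have hn' : (0:ℝ) < n := by exact_mod_cast hn
  have hl0 : ∀ j, 0 ≤ l j := fun j => by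
    obtain ⟨v, hv1, hv2⟩ := h3 j
    rw [hv2]; exact h0 v
  have hlC : ∀ j, l j ≤ C := fun j => by
    obtain ⟨v, hv1, hv2⟩ := h3 j
    have h5 := hC v
    rw [hv1, mul_one] at h5
    rw [hv2]; exact h5
  simp only [qf, hq]
  rw [sphere_rot_integral hR hRm (F := fun v => (n * (∑ j, l j * v j ^ 2) - M.trace) ^ 4)
    (by fun_prop)]
  have htr0 : 0 ≤ M.trace / n := by
    rw [← h1]; exact div_nonneg (Finset.sum_nonneg fun j _ => hl0 j) hn'.le
  have htrC : M.trace / n ≤ C := by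
    rw [div_le_iff₀ hn', ← h1]
    refine (Finset.sum_le_sum fun j _ => hlC j).trans ?_
    simp [mul_comm]
  have := sphere_fourth hn (fun j => l j - M.trace / n) (by simp [h1]; field_simp; simp) C
    (fun j => by rw [abs_le]; constructor <;> linarith [hl0 j, hlC j])
  refine le_of_eq_of_le (integral_congr_ae ?_) this
  filter_upwards [sphere_norm hn] with v hv
  simp only [sub_mul, Finset.sum_sub_distrib, ← Finset.mul_sum, hv]
  rw [mul_sub]
  field_simp

theorem sphere_qf_ne {n : ℕ} (M : Matrix (Fin n) (Fin n) ℝ) (hM : Mᵀ = M)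
    (h0 : ∀ v, 0 ≤ qf M v) (ht : 0 < M.trace) : ∀ᵐ v ∂(uniformSphere n), qf M v ≠ 0 := by
  obtain ⟨l, R, hR, hRm, hq, h1, h2, h3⟩ := diag_exists M hM
  have hl0 : ∀ j, 0 ≤ l j := fun j => by
    obtain ⟨v, hv1, hv2⟩ := h3 j
    rw [hv2]; exact h0 v
  have : ∃ j, 0 < l j := by
    by_contra hcon
    push Not at hcon
    have := Finset.sum_nonpos fun j (_ : j ∈ Finset.univ) => hcon j
    linarith
  obtain ⟨j, hj⟩ := this
  have hmp : MeasurePreserving R (uniformSphere n) (uniformSphere n) := ⟨hR, hRm⟩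
  filter_upwards [hmp.quasiMeasurePreserving.ae (sphere_coord_ne j)] with v hv
  have : 0 < ∑ j, l j * (R v j) ^ 2 :=
    Finset.sum_pos' (fun i _ => mul_nonneg (hl0 i) (sq_nonneg _))
      ⟨j, Finset.mem_univ _, by positivity⟩
  simp only [qf, hq]; exact this.ne'

open MeasureTheory ProbabilityTheory Matrix Filter Topology

/-- deviation of the squared diagonal -/
def dv {n : ℕ} (a : Fin n → ℝ) (k : Fin n) : ℝ := a k ^ 2 - 1

/-- the matrix `A P A` -/
def Mm {n : ℕ} (a : Fin n → ℝ) (P : Matrix (Fin n) (Fin n) ℝ) : Matrix (Fin n) (Fin n) ℝ :=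
  diagonal a * P * diagonal a

/-- the matrix `A P D P A` -/
def Nm {n : ℕ} (a : Fin n → ℝ) (P : Matrix (Fin n) (Fin n) ℝ) : Matrix (Fin n) (Fin n) ℝ :=
  diagonal a * (P * diagonal (dv a) * P) * diagonal a

/-- `tr (D P)` -/
def Xs {n : ℕ} (a : Fin n → ℝ) (P : Matrix (Fin n) (Fin n) ℝ) : ℝ := ∑ k, dv a k * P k k

/-- `tr (D P D P)` -/
def Ys {n : ℕ} (a : Fin n → ℝ) (P : Matrix (Fin n) (Fin n) ℝ) : ℝ :=
  ∑ k, ∑ l, dv a k * dv a l * P k l ^ 2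

section det
variable {n : ℕ} {a : Fin n → ℝ} {P : Matrix (Fin n) (Fin n) ℝ}

theorem proj_sym (hs : Pᵀ = P) (k l : Fin n) : P l k = P k l := by
  conv_lhs => rw [← hs]
  rfl

theorem proj_diag (hs : Pᵀ = P) (hi : P * P = P) (k : Fin n) : P k k = ∑ l, P k l ^ 2 := by
  conv_lhs => rw [← hi]
  rw [mul_apply]
  exact Finset.sum_congr rfl fun l _ => by rw [proj_sym hs k l]; ring

theorem proj_diag_nonneg (hs : Pᵀ = P) (hi : P * P = P) (k : Fin n) : 0 ≤ P k k := by
  rw [proj_diag hs hi]; positivity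

theorem proj_diag_le (hs : Pᵀ = P) (hi : P * P = P) (k : Fin n) : P k k ≤ 1 := by
  have h := proj_diag hs hi k
  have h2 : P k k ^ 2 ≤ ∑ l, P k l ^ 2 :=
    Finset.single_le_sum (f := fun l => P k l ^ 2) (fun i _ => sq_nonneg _) (Finset.mem_univ k)
  nlinarith

theorem proj_entry_le (hs : Pᵀ = P) (hi : P * P = P) (k l : Fin n) : |P k l| ≤ 1 := by
  have h := proj_diag hs hi k
  have h2 : P k l ^ 2 ≤ ∑ l, P k l ^ 2 :=
    Finset.single_le_sum (f := fun l => P k l ^ 2) (fun i _ => sq_nonneg _) (Finset.mem_univ l)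
  rw [← sq_le_one_iff_abs_le_one]
  linarith [proj_diag_le hs hi k]

theorem Mm_apply (k l : Fin n) : Mm a P k l = a k * P k l * a l := by
  simp [Mm, diagonal_mul, mul_diagonal]

theorem Mm_sym (hs : Pᵀ = P) : (Mm a P)ᵀ = Mm a P := by
  simp [Mm, transpose_mul, hs, Matrix.mul_assoc]

theorem Nm_sym (hs : Pᵀ = P) : (Nm a P)ᵀ = Nm a P := by
  simp [Nm, transpose_mul, hs, Matrix.mul_assoc]

theorem Mm_trace : (Mm a P).trace = P.trace + Xs a P := by
  simp only [trace, diag_apply, Mm_apply, Xs, ← Finset.sum_add_distrib]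
  exact Finset.sum_congr rfl fun k _ => by simp only [dv]; ring

theorem Mm_trace2_eq (hs : Pᵀ = P) :
    (Mm a P * Mm a P).trace = ∑ k, ∑ l, a k ^ 2 * a l ^ 2 * P k l ^ 2 := by
  simp only [trace, diag_apply, mul_apply, Mm_apply]
  exact Finset.sum_congr rfl fun k _ => Finset.sum_congr rfl fun l _ => by
    rw [proj_sym hs k l]; ring

theorem Mm_trace2 (hs : Pᵀ = P) (hi : P * P = P) :
    (Mm a P * Mm a P).trace = P.trace + 2 * Xs a P + Ys a P := by
  have h1 : P.trace = ∑ k, ∑ l, P k l ^ 2 :=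
    Finset.sum_congr rfl fun k _ => proj_diag hs hi k
  have h2 : Xs a P = ∑ k, ∑ l, dv a k * P k l ^ 2 :=
    Finset.sum_congr rfl fun k _ => by rw [proj_diag hs hi k, Finset.mul_sum]
  have h3 : Xs a P = ∑ k, ∑ l, dv a l * P k l ^ 2 := by
    rw [h2, Finset.sum_comm]
    exact Finset.sum_congr rfl fun k _ => Finset.sum_congr rfl fun l _ => by rw [proj_sym hs k l]
  have h4 : P.trace + 2 * Xs a P + Ys a P = ∑ k, ∑ l, P k l ^ 2 + ∑ k, ∑ l, dv a k * P k l ^ 2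
      + ∑ k, ∑ l, dv a l * P k l ^ 2 + Ys a P := by
    rw [← h1, ← h2, ← h3]; ring
  rw [Mm_trace2_eq hs, h4, Ys]
  simp only [← Finset.sum_add_distrib]
  exact Finset.sum_congr rfl fun k _ => Finset.sum_congr rfl fun l _ => by simp only [dv]; ring

theorem K_apply (k l : Fin n) : (P * diagonal (dv a) * P) k l = ∑ j, P k j * dv a j * P j l := by
  rw [mul_apply]
  simp only [mul_diagonal]

theorem K_sq (hs : Pᵀ = P) (hi : P * P = P) :
    ∑ k, ∑ l, (P * diagonal (dv a) * P) k l ^ 2 = Ys a P := by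
  set K := P * diagonal (dv a) * P with hK
  have hKs : Kᵀ = K := by simp [hK, transpose_mul, hs, Matrix.mul_assoc]
  have h1 : ∑ k, ∑ l, K k l ^ 2 = (K * K).trace := by
    simp only [trace, diag_apply, mul_apply]
    exact Finset.sum_congr rfl fun k _ => Finset.sum_congr rfl fun l _ => by
      rw [proj_sym hKs k l]; ring
  have h2 : K * K = P * (diagonal (dv a) * P * diagonal (dv a) * P) := by
    calc K * K = P * (diagonal (dv a) * (P * P) * diagonal (dv a) * P) := by
          simp only [hK, Matrix.mul_assoc]
      _ = _ := by rw [hi]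
  have h3 : (K * K).trace = ((diagonal (dv a) * P) * (diagonal (dv a) * P)).trace := by
    rw [h2, trace_mul_comm]
    congr 1
    calc diagonal (dv a) * P * diagonal (dv a) * P * P
        = diagonal (dv a) * P * (diagonal (dv a) * (P * P)) := by simp only [Matrix.mul_assoc]
      _ = _ := by rw [hi]
  rw [h1, h3]
  simp only [trace, diag_apply, Ys]
  refine Finset.sum_congr rfl fun k _ => ?_
  rw [mul_apply]
  exact Finset.sum_congr rfl fun l _ => by
    rw [diagonal_mul, diagonal_mul, proj_sym hs k l]; ring

theorem Nm_apply (k l : Fin n) : Nm a P k l = a k * (P * diagonal (dv a) * P) k l * a l := by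
  simp only [Nm, diagonal_mul, mul_diagonal]

theorem Nm_trace (hs : Pᵀ = P) (hi : P * P = P) : (Nm a P).trace = Xs a P + Ys a P := by
  have h2 : Xs a P = ∑ k, ∑ l, dv a l * P k l ^ 2 := by
    have : Xs a P = ∑ k, ∑ l, dv a k * P k l ^ 2 :=
      Finset.sum_congr rfl fun k _ => by rw [proj_diag hs hi k, Finset.mul_sum]
    rw [this, Finset.sum_comm]
    exact Finset.sum_congr rfl fun k _ => Finset.sum_congr rfl fun l _ => by rw [proj_sym hs k l]
  rw [h2, Ys]
  simp only [trace, diag_apply, Nm_apply, K_apply, Finset.mul_sum, Finset.sum_mul,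
    ← Finset.sum_add_distrib]
  exact Finset.sum_congr rfl fun k _ => Finset.sum_congr rfl fun l _ => by
    rw [proj_sym hs k l]; simp only [dv]; ring

theorem Nm_trace2 (hs : Pᵀ = P) (hi : P * P = P) (C : ℝ) (haC : ∀ k, a k ^ 2 ≤ C) :
    (Nm a P * Nm a P).trace ≤ C ^ 2 * Ys a P := by
  have hKs : (P * diagonal (dv a) * P)ᵀ = P * diagonal (dv a) * P := by
    simp [transpose_mul, hs, Matrix.mul_assoc]
  rw [← K_sq hs hi, Finset.mul_sum]
  simp only [trace, diag_apply, mul_apply (M := Nm a P), Nm_apply]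
  refine Finset.sum_le_sum fun k _ => ?_
  rw [Finset.mul_sum]
  refine Finset.sum_le_sum fun l _ => ?_
  rw [proj_sym hKs k l]
  set z := (P * diagonal (dv a) * P) k l
  have : a k ^ 2 * a l ^ 2 ≤ C * C :=
    mul_le_mul (haC k) (haC l) (sq_nonneg _) ((sq_nonneg _).trans (haC k))
  nlinarith [mul_le_mul_of_nonneg_right this (sq_nonneg z)]

theorem Ys_nonneg (hs : Pᵀ = P) (hi : P * P = P) : 0 ≤ Ys a P := by
  rw [← K_sq hs hi]; positivity

theorem Ys_le (hs : Pᵀ = P) (hi : P * P = P) {δ : ℝ} (hδ : ∑ k, dv a k ^ 2 ≤ δ ^ 2) :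
    Ys a P ≤ δ ^ 2 := by
  have h1 : Ys a P ≤ ∑ k, ∑ l, (dv a k ^ 2 / 2 * P k l ^ 2 + dv a l ^ 2 / 2 * P k l ^ 2) := by
    refine Finset.sum_le_sum fun k _ => Finset.sum_le_sum fun l _ => ?_
    nlinarith [mul_nonneg (sq_nonneg (dv a k - dv a l)) (sq_nonneg (P k l))]
  simp only [Finset.sum_add_distrib] at h1
  have h2 : ∑ k, ∑ l, dv a l ^ 2 / 2 * P k l ^ 2 = ∑ k, ∑ l, dv a k ^ 2 / 2 * P k l ^ 2 := by
    rw [Finset.sum_comm]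
    exact Finset.sum_congr rfl fun k _ => Finset.sum_congr rfl fun l _ => by rw [proj_sym hs k l]
  have h3 : ∑ k, ∑ l, dv a k ^ 2 / 2 * P k l ^ 2 ≤ ∑ k, dv a k ^ 2 / 2 := by
    refine Finset.sum_le_sum fun k _ => ?_
    rw [← Finset.mul_sum, ← proj_diag hs hi]
    exact mul_le_of_le_one_right (by positivity) (proj_diag_le hs hi k)
  rw [← Finset.sum_div] at h3
  linarith

theorem Xs_sq_le (hs : Pᵀ = P) (hi : P * P = P) {δ : ℝ} (hδ : ∑ k, dv a k ^ 2 ≤ δ ^ 2) :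
    Xs a P ^ 2 ≤ P.trace * δ ^ 2 := by
  have h1 := Finset.sum_mul_sq_le_sq_mul_sq Finset.univ (dv a) (fun k => P k k)
  have h2 : ∑ k, P k k ^ 2 ≤ P.trace := by
    refine Finset.sum_le_sum fun k _ => ?_
    have := proj_diag_nonneg hs hi k
    have := proj_diag_le hs hi k
    simp only [diag_apply]
    nlinarith
  have h3 : 0 ≤ ∑ k, P k k ^ 2 := by positivity
  have h4 : 0 ≤ ∑ k, dv a k ^ 2 := by positivity
  calc Xs a P ^ 2 ≤ (∑ k, dv a k ^ 2) * ∑ k, P k k ^ 2 := h1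
    _ ≤ δ ^ 2 * P.trace := mul_le_mul hδ h2 h3 (h4.trans hδ)
    _ = _ := by ring

theorem Mm_trace_ge (hs : Pᵀ = P) (hi : P * P = P) (C : ℝ) (haC : ∀ k, C⁻¹ ≤ a k ^ 2) :
    C⁻¹ * P.trace ≤ (Mm a P).trace := by
  simp only [trace, diag_apply, Mm_apply, Finset.mul_sum]
  refine Finset.sum_le_sum fun k _ => ?_
  nlinarith [mul_le_mul_of_nonneg_right (haC k) (proj_diag_nonneg hs hi k)]

theorem Mm_trace2_le (hs : Pᵀ = P) (hi : P * P = P) (C : ℝ) (haC : ∀ k, a k ^ 2 ≤ C) :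
    (Mm a P * Mm a P).trace ≤ C ^ 2 * P.trace := by
  have h1 : P.trace = ∑ k, ∑ l, P k l ^ 2 :=
    Finset.sum_congr rfl fun k _ => proj_diag hs hi k
  rw [Mm_trace2_eq hs, h1, Finset.mul_sum]
  refine Finset.sum_le_sum fun k _ => ?_
  rw [Finset.mul_sum]
  refine Finset.sum_le_sum fun l _ => ?_
  have : a k ^ 2 * a l ^ 2 ≤ C * C :=
    mul_le_mul (haC k) (haC l) (sq_nonneg _) ((sq_nonneg _).trans (haC k))
  nlinarith [mul_le_mul_of_nonneg_right this (sq_nonneg (P k l))]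

theorem qf_Mm (hs : Pᵀ = P) (hi : P * P = P) (v : Fin n → ℝ) :
    qf (Mm a P) v = ∑ k, (P *ᵥ (diagonal a *ᵥ v)) k ^ 2 := by
  have : Mm a P = diagonal a * P * (P * diagonal a) := by
    rw [Mm]; conv_lhs => rw [← hi]
    simp only [Matrix.mul_assoc]
  have h2 : v ᵥ* (diagonal a * P) = P *ᵥ (diagonal a *ᵥ v) := by
    rw [← mulVec_transpose, transpose_mul, hs, diagonal_transpose, mulVec_mulVec]
  rw [qf, this, ← mulVec_mulVec, dotProduct_mulVec, h2, ← mulVec_mulVec, dotProduct]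
  exact Finset.sum_congr rfl fun k _ => by ring

theorem qf_Nm (hs : Pᵀ = P) (v : Fin n → ℝ) :
    qf (Nm a P) v = ∑ k, dv a k * (P *ᵥ (diagonal a *ᵥ v)) k ^ 2 := by
  have : Nm a P = diagonal a * P * (diagonal (dv a) * (P * diagonal a)) := by
    simp only [Nm, Matrix.mul_assoc]
  have h2 : v ᵥ* (diagonal a * P) = P *ᵥ (diagonal a *ᵥ v) := by
    rw [← mulVec_transpose, transpose_mul, hs, diagonal_transpose, mulVec_mulVec]
  rw [qf, this, ← mulVec_mulVec, dotProduct_mulVec, h2, ← mulVec_mulVec, ← mulVec_mulVec, dotProduct]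
  exact Finset.sum_congr rfl fun k _ => by rw [mulVec_diagonal]; ring

theorem qf_Mm_nonneg (hs : Pᵀ = P) (hi : P * P = P) (v : Fin n → ℝ) : 0 ≤ qf (Mm a P) v := by
  rw [qf_Mm hs hi]; positivity

theorem proj_norm_le (hs : Pᵀ = P) (hi : P * P = P) (w : Fin n → ℝ) :
    ∑ k, (P *ᵥ w) k ^ 2 ≤ ∑ k, w k ^ 2 := by
  have h1 : ∑ k, (P *ᵥ w) k ^ 2 = ∑ k, w k * (P *ᵥ w) k := by
    have e1 : ∑ k, (P *ᵥ w) k ^ 2 = (P *ᵥ w) ⬝ᵥ (P *ᵥ w) :=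
      Finset.sum_congr rfl fun k _ => by ring
    have e2 : w ᵥ* P = P *ᵥ w := by rw [← mulVec_transpose, hs]
    have e3 : (P *ᵥ w) ⬝ᵥ (P *ᵥ w) = w ⬝ᵥ (P *ᵥ w) := by
      conv_rhs => rw [← hi, ← mulVec_mulVec, dotProduct_mulVec, e2]
    rw [e1, e3]; rfl
  have h2 : 0 ≤ ∑ k, (w k - (P *ᵥ w) k) ^ 2 := by positivity
  have h3 : ∑ k, (w k - (P *ᵥ w) k) ^ 2 = ∑ k, w k ^ 2 - 2 * ∑ k, w k * (P *ᵥ w) k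
      + ∑ k, (P *ᵥ w) k ^ 2 := by
    rw [Finset.mul_sum, ← Finset.sum_sub_distrib, ← Finset.sum_add_distrib]
    exact Finset.sum_congr rfl fun k _ => by ring
  linarith

theorem qf_Mm_le (hs : Pᵀ = P) (hi : P * P = P) (C : ℝ) (haC : ∀ k, a k ^ 2 ≤ C)
    (v : Fin n → ℝ) : qf (Mm a P) v ≤ C * (v ⬝ᵥ v) := by
  rw [qf_Mm hs hi]
  refine (proj_norm_le hs hi _).trans ?_
  rw [dotProduct, Finset.mul_sum]
  refine Finset.sum_le_sum fun k _ => ?_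
  rw [mulVec_diagonal, mul_pow]
  nlinarith [mul_le_mul_of_nonneg_right (haC k) (sq_nonneg (v k))]

theorem dv_abs_le {δ : ℝ} (hδ0 : 0 ≤ δ) (hδ : ∑ k, dv a k ^ 2 ≤ δ ^ 2) (k : Fin n) :
    |dv a k| ≤ δ := by
  refine abs_le_of_sq_le_sq ?_ hδ0
  exact (Finset.single_le_sum (f := fun l => dv a l ^ 2) (fun i _ => sq_nonneg _)
    (Finset.mem_univ k)).trans hδ

theorem qf_Nm_le (hs : Pᵀ = P) (hi : P * P = P) {δ : ℝ} (hδ0 : 0 ≤ δ)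
    (hδ : ∑ k, dv a k ^ 2 ≤ δ ^ 2) (v : Fin n → ℝ) :
    |qf (Nm a P) v| ≤ δ * qf (Mm a P) v := by
  rw [qf_Mm hs hi, qf_Nm hs, Finset.mul_sum]
  refine (Finset.abs_sum_le_sum_abs _ _).trans (Finset.sum_le_sum fun k _ => ?_)
  rw [abs_mul, abs_of_nonneg (sq_nonneg ((P *ᵥ (diagonal a *ᵥ v)) k))]
  exact mul_le_mul_of_nonneg_right (dv_abs_le hδ0 hδ k) (sq_nonneg _)

end det

open MeasureTheory ProbabilityTheory Matrix Filter Topology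

/-- the increment ratio -/
noncomputable def qr {n : ℕ} (a : Fin n → ℝ) (P : Matrix (Fin n) (Fin n) ℝ) (v : Fin n → ℝ) : ℝ :=
  qf (Nm a P) v / qf (Mm a P) v

theorem measurable_qr {n : ℕ} (a : Fin n → ℝ) (P : Matrix (Fin n) (Fin n) ℝ) :
    Measurable (qr a P) := (measurable_qf _).div (measurable_qf _)

/-- constants of the one step estimate -/
noncomputable def stepK (C κ : ℝ) : ℝ :=
  ((16 * C ^ 2 / κ ^ 2) / 2 + C ^ 2 + 1) / κ + 16 * C ^ 2 / κ ^ 2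

section step
variable {n : ℕ} {a : Fin n → ℝ} {P : Matrix (Fin n) (Fin n) ℝ}

theorem qr_mul (hs : Pᵀ = P) (hi : P * P = P) {δ : ℝ} (hδ0 : 0 ≤ δ)
    (hδ : ∑ k, dv a k ^ 2 ≤ δ ^ 2) (v : Fin n → ℝ) :
    qr a P v * qf (Mm a P) v = qf (Nm a P) v := by
  unfold qr
  by_cases h : qf (Mm a P) v = 0
  · have := qf_Nm_le hs hi hδ0 hδ v
    rw [h, mul_zero] at this
    rw [h, abs_nonpos_iff.1 this]; simp
  · field_simp

theorem qr_le (hs : Pᵀ = P) (hi : P * P = P) {δ : ℝ} (hδ0 : 0 ≤ δ)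
    (hδ : ∑ k, dv a k ^ 2 ≤ δ ^ 2) (v : Fin n → ℝ) : |qr a P v| ≤ δ := by
  have h := qf_Nm_le hs hi hδ0 hδ v
  have h0 := qf_Mm_nonneg (a := a) hs hi v
  unfold qr
  rw [abs_div, abs_of_nonneg h0]
  exact div_le_of_le_mul₀ h0 hδ0 h

set_option maxHeartbeats 2000000 in
theorem step_bound (hn : 0 < n) (hs : Pᵀ = P) (hi : P * P = P) {δ : ℝ} (hδ0 : 0 < δ) (hδ1 : δ ≤ 1)
    (hδ : ∑ k, dv a k ^ 2 ≤ δ ^ 2) {C κ : ℝ} (hC : 1 ≤ C) (haC : ∀ k, a k ^ 2 ≤ C)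
    (hκ : 0 < κ) (hb : κ * n ≤ (Mm a P).trace) (hm : P.trace ≤ n) :
    ∫ v, (Xs a P - qr a P v) ^ 2 ∂(uniformSphere n)
      ≤ Xs a P ^ 2 + stepK C κ * (δ / n) * (1 + Xs a P ^ 2) := by
  have hn' : (0:ℝ) < n := by exact_mod_cast hn
  have hn1 : (1:ℝ) ≤ n := by exact_mod_cast hn
  set b := (Mm a P).trace with hbdef
  set X := Xs a P with hX
  set ν := uniformSphere n
  have hb0 : 0 < b := lt_of_lt_of_le (by positivity) hb
  have hqi : Integrable (qr a P) ν :=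
    integrable_bdd (measurable_qr a P) δ (ae_of_all _ fun v => qr_le hs hi hδ0.le hδ v)
  have hq2i : Integrable (fun v => qr a P v ^ 2) ν := by
    refine integrable_bdd ((measurable_qr a P).pow_const 2) (δ ^ 2) (ae_of_all _ fun v => ?_)
    rw [abs_pow]; exact pow_le_pow_left₀ (abs_nonneg _) (qr_le hs hi hδ0.le hδ v) 2
  -- moments
  have hvar : ∫ v, (n * qf (Mm a P) v - b) ^ 2 ∂ν ≤ 2 * C ^ 2 * n := by
    rw [sphere_qf_c hn _ (Mm_sym hs)]
    have h1 := Mm_trace2_le hs hi C haC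
    have h2 : (Mm a P * Mm a P).trace ≤ C ^ 2 * n := h1.trans (by gcongr)
    rw [← hbdef, sub_self, div_add' _ _ _ (by positivity), div_le_iff₀ (by positivity)]
    have h3 := mul_le_mul_of_nonneg_left h2 hn'.le
    nlinarith [sq_nonneg b, mul_pos (by positivity : (0:ℝ) < C^2) hn']
  have hY0 := Ys_nonneg (a := a) hs hi
  have hY := Ys_le hs hi hδ
  have hXs : X ^ 2 ≤ n * δ ^ 2 := (Xs_sq_le hs hi hδ).trans (by gcongr)
  have htN : (Nm a P).trace = X + Ys a P := Nm_trace hs hi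
  have hx2 : ∫ v, (n * qf (Nm a P) v) ^ 2 ∂ν ≤ 6 * C ^ 2 * n * δ ^ 2 := by
    rw [sphere_qf_m2 hn _ (Nm_sym hs), htN]
    have h1 : (Nm a P * Nm a P).trace ≤ C ^ 2 * δ ^ 2 :=
      (Nm_trace2 hs hi C haC).trans (by gcongr)
    have h2 : (X + Ys a P) ^ 2 ≤ 4 * n * δ ^ 2 := by
      have h3 : Ys a P ^ 2 ≤ n * δ ^ 2 := by
        have : Ys a P ^ 2 ≤ δ ^ 2 * δ ^ 2 := by rw [sq]; gcongr
        have h4 : δ ^ 2 * δ ^ 2 ≤ 1 * δ ^ 2 := by gcongr; exact pow_le_one₀ hδ0.le hδ1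
        nlinarith [sq_nonneg δ]
      nlinarith [sq_nonneg (X - Ys a P)]
    have h5 : 2 * (Nm a P * Nm a P).trace + (X + Ys a P) ^ 2 ≤ 6 * C ^ 2 * n * δ ^ 2 := by
      have hd : 0 ≤ δ ^ 2 := sq_nonneg _
      have e1 : C ^ 2 * δ ^ 2 ≤ C ^ 2 * δ ^ 2 * n := le_mul_of_one_le_right (by positivity) hn1
      have e2 : n * δ ^ 2 ≤ C ^ 2 * (n * δ ^ 2) :=
        le_mul_of_one_le_left (by positivity) (one_le_pow₀ hC)
      nlinarith
    rw [div_le_iff₀ (by positivity)]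
    have h6 := mul_le_mul_of_nonneg_left h5 hn'.le
    have : 0 ≤ 6 * C ^ 2 * n * δ ^ 2 := by positivity
    nlinarith
  -- pointwise identity
  have hpt : ∀ v, b * qr a P v = n * qf (Nm a P) v - qr a P v * (n * qf (Mm a P) v - b) := by
    intro v
    rw [← qr_mul hs hi hδ0.le hδ v]; ring
  have hEq2 : b ^ 2 * ∫ v, qr a P v ^ 2 ∂ν ≤ 16 * C ^ 2 * n * δ ^ 2 := by
    have h1 : ∫ v, b ^ 2 * qr a P v ^ 2 ∂ν
        ≤ ∫ v, (2 * (n * qf (Nm a P) v) ^ 2 + 2 * δ ^ 2 * (n * qf (Mm a P) v - b) ^ 2) ∂ν := by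
      refine integral_mono (hq2i.const_mul _)
        (((sphere_qf_int2 _).const_mul _).add ((sphere_qf_cint _ _).const_mul _)) fun v => ?_
      simp only
      rw [← mul_pow, hpt v]
      have hq : qr a P v ^ 2 ≤ δ ^ 2 := sq_le_sq' (abs_le.1 (qr_le hs hi hδ0.le hδ v)).1
        (abs_le.1 (qr_le hs hi hδ0.le hδ v)).2
      have := mul_le_mul_of_nonneg_right hq (sq_nonneg (n * qf (Mm a P) v - b))
      nlinarith [sq_nonneg (n * qf (Nm a P) v + qr a P v * (n * qf (Mm a P) v - b))]
    rw [integral_const_mul, integral_add ((sphere_qf_int2 _).const_mul _)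
      ((sphere_qf_cint _ _).const_mul _), integral_const_mul, integral_const_mul] at h1
    have := mul_le_mul_of_nonneg_left hvar (sq_nonneg δ)
    nlinarith
  set K0 := 16 * C ^ 2 / κ ^ 2 with hK0
  have hEq2' : ∫ v, qr a P v ^ 2 ∂ν ≤ K0 * δ ^ 2 / n := by
    have h0 : 0 ≤ ∫ v, qr a P v ^ 2 ∂ν := integral_nonneg fun v => sq_nonneg _
    have h1 : (κ * n) ^ 2 * ∫ v, qr a P v ^ 2 ∂ν ≤ 16 * C ^ 2 * n * δ ^ 2 :=
      (mul_le_mul_of_nonneg_right (pow_le_pow_left₀ (by positivity) hb 2) h0).trans hEq2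
    have : K0 * δ ^ 2 / n = (16 * C ^ 2 * n * δ ^ 2) / (κ * n) ^ 2 := by
      rw [hK0]; field_simp
    rw [this, le_div_iff₀ (by positivity)]
    linarith
  have hcross : |b * ∫ v, qr a P v ∂ν - (X + Ys a P)| ≤ (K0 / 2 + C ^ 2) * δ := by
    have hci : Integrable (fun v => qr a P v * (n * qf (Mm a P) v - b)) ν := by
      have : (fun v => qr a P v * (n * qf (Mm a P) v - b)) =
          fun v => n * qf (Nm a P) v - b * qr a P v := by
        ext v; rw [hpt v]; ring
      rw [this]
      exact (sphere_qf_int _).sub (hqi.const_mul _)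
    have h1 : b * ∫ v, qr a P v ∂ν = (X + Ys a P) - ∫ v, qr a P v * (n * qf (Mm a P) v - b) ∂ν := by
      rw [← integral_const_mul, ← htN, ← sphere_qf_m1 hn _ (Nm_sym hs),
        ← integral_sub (sphere_qf_int _) hci]
      exact integral_congr_ae (ae_of_all _ hpt)
    rw [h1, sub_sub_cancel_left, abs_neg]
    refine (abs_integral_le_integral_abs).trans ?_
    have h2 : ∫ v, |qr a P v * (n * qf (Mm a P) v - b)| ∂ν ≤
        ∫ v, ((n / δ / 2) * qr a P v ^ 2 + (δ / n / 2) * (n * qf (Mm a P) v - b) ^ 2) ∂ν := by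
      refine integral_mono hci.abs ((hq2i.const_mul _).add ((sphere_qf_cint _ _).const_mul _))
        fun v => ?_
      simp only
      generalize n * qf (Mm a P) v - b = w
      generalize qr a P v = q
      rw [abs_mul, ← sq_abs q, ← sq_abs w]
      have e : n / δ / 2 * |q| ^ 2 + δ / n / 2 * |w| ^ 2 - |q| * |w|
          = (n * |q| - δ * |w|) ^ 2 / (2 * δ * n) := by field_simp; ring
      have : 0 ≤ (n * |q| - δ * |w|) ^ 2 / (2 * δ * n) := by positivity
      linarith
    rw [integral_add (hq2i.const_mul _) ((sphere_qf_cint _ _).const_mul _), integral_const_mul,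
      integral_const_mul] at h2
    have h3 : n / δ / 2 * ∫ v, qr a P v ^ 2 ∂ν ≤ K0 / 2 * δ := by
      refine (mul_le_mul_of_nonneg_left hEq2' (by positivity)).trans (le_of_eq ?_)
      field_simp
    have h4 : δ / n / 2 * ∫ v, (n * qf (Mm a P) v - b) ^ 2 ∂ν ≤ C ^ 2 * δ := by
      refine (mul_le_mul_of_nonneg_left hvar (by positivity)).trans (le_of_eq ?_)
      field_simp
    linarith
  -- conclusion
  have hexp : ∫ v, (X - qr a P v) ^ 2 ∂ν
      = X ^ 2 - 2 * X * (∫ v, qr a P v ∂ν) + ∫ v, qr a P v ^ 2 ∂ν := by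
    have : (fun v => (X - qr a P v) ^ 2) = fun v => (X ^ 2 - 2 * X * qr a P v) + qr a P v ^ 2 := by
      ext v; ring
    have hsi : Integrable (fun v => X ^ 2 - 2 * X * qr a P v) ν :=
      (integrable_const _).sub (hqi.const_mul _)
    rw [this, integral_add hsi hq2i,
      integral_sub (integrable_const _) (hqi.const_mul _), integral_const_mul]
    simp
  rw [hexp]
  set E1 := ∫ v, qr a P v ∂ν
  set K3 := K0 / 2 + C ^ 2 with hK3
  have hK00 : 0 ≤ K0 := by positivity
  have hK30 : 0 ≤ K3 := by positivity
  have hYδ : Ys a P ≤ δ := hY.trans (by rw [sq]; exact mul_le_of_le_one_left hδ0.le hδ1)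
  have h4X : 2 * |X| ≤ 1 + X ^ 2 := by
    clear * -
    rw [← sq_abs X]; nlinarith [sq_nonneg (|X| - 1)]
  have hlin : -(2 * X * E1) ≤ (K3 + 1) * δ / (κ * n) * (1 + X ^ 2) := by
    have e1 : -(2 * X * (b * E1)) ≤ (K3 + 1) * δ * (1 + X ^ 2) := by
      have h1 : -(2 * X * (b * E1)) = -2 * X ^ 2 - 2 * X * Ys a P
        - 2 * X * (b * E1 - (X + Ys a P)) := by ring
      have h2 : |X * Ys a P| ≤ |X| * δ := by
        rw [abs_mul, abs_of_nonneg hY0]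
        gcongr
      have h3 : |X * (b * E1 - (X + Ys a P))| ≤ |X| * (K3 * δ) := by
        rw [abs_mul]; gcongr
      have h4 : 2 * |X| ≤ 1 + X ^ 2 := by exact h4X
      have h5 := neg_abs_le (X * Ys a P)
      have h6 := neg_abs_le (X * (b * E1 - (X + Ys a P)))
      have h7 : 2 * |X| * ((K3 + 1) * δ) ≤ (1 + X ^ 2) * ((K3 + 1) * δ) := by gcongr
      linarith [sq_nonneg X]
    have e2 : -(2 * X * E1) = -(2 * X * (b * E1)) / b := by field_simp
    rw [e2]
    calc _ ≤ (K3 + 1) * δ * (1 + X ^ 2) / b := by gcongr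
      _ ≤ (K3 + 1) * δ * (1 + X ^ 2) / (κ * n) := by gcongr
      _ = _ := by ring
  have hq : ∫ v, qr a P v ^ 2 ∂ν ≤ K0 * (δ / n) * (1 + X ^ 2) := by
    refine hEq2'.trans ?_
    calc K0 * δ ^ 2 / n = K0 * (δ / n) * δ := by ring
      _ ≤ _ := by
        gcongr
        linarith [sq_nonneg X]
  have hst : stepK C κ = (K3 + 1) / κ + K0 := rfl
  have : stepK C κ * (δ / n) * (1 + X ^ 2) = (K3 + 1) * δ / (κ * n) * (1 + X ^ 2)
      + K0 * (δ / n) * (1 + X ^ 2) := by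
    rw [hst]; field_simp
  linarith

end step

open MeasureTheory ProbabilityTheory Matrix Filter Topology

/-- projection on the orthogonal complement of the rows -/
noncomputable def prj {i n : ℕ} (B : Matrix (Fin i) (Fin n) ℝ) : Matrix (Fin n) (Fin n) ℝ :=
  1 - Bᵀ * (B * Bᵀ)⁻¹ * B

theorem prj_sym {i n : ℕ} (B : Matrix (Fin i) (Fin n) ℝ) : (prj B)ᵀ = prj B := by
  simp [prj, transpose_sub, transpose_mul, transpose_nonsing_inv, Matrix.mul_assoc]

theorem prj_idem {i n : ℕ} (B : Matrix (Fin i) (Fin n) ℝ) : prj B * prj B = prj B := by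
  by_cases h : IsUnit (B * Bᵀ).det
  · have h1 : Bᵀ * (B * Bᵀ)⁻¹ * B * (Bᵀ * (B * Bᵀ)⁻¹ * B) = Bᵀ * (B * Bᵀ)⁻¹ * B := by
      calc _ = Bᵀ * ((B * Bᵀ)⁻¹ * (B * Bᵀ)) * (B * Bᵀ)⁻¹ * B := by simp only [Matrix.mul_assoc]
        _ = _ := by rw [nonsing_inv_mul _ h, Matrix.mul_one]
    unfold prj
    rw [Matrix.sub_mul, Matrix.mul_sub, Matrix.mul_sub, h1]
    simp
  · simp [prj, nonsing_inv_apply_not_isUnit _ h]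

theorem mul_prj {i n : ℕ} (B : Matrix (Fin i) (Fin n) ℝ) (h : IsUnit (B * Bᵀ).det) :
    B * prj B = 0 := by
  unfold prj
  rw [Matrix.mul_sub, Matrix.mul_one, ← Matrix.mul_assoc, ← Matrix.mul_assoc,
    mul_nonsing_inv _ h, Matrix.one_mul, sub_self]

theorem prj_mul {i n : ℕ} (B : Matrix (Fin i) (Fin n) ℝ) (h : IsUnit (B * Bᵀ).det) :
    prj B * Bᵀ = 0 := by
  have := congrArg transpose (mul_prj B h)
  rwa [transpose_mul, prj_sym, transpose_zero] at this

theorem prj_trace {i n : ℕ} (B : Matrix (Fin i) (Fin n) ℝ) (h : IsUnit (B * Bᵀ).det) :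
    (prj B).trace = n - i := by
  unfold prj
  rw [trace_sub, trace_one, Matrix.mul_assoc, trace_mul_comm, Matrix.mul_assoc,
    nonsing_inv_mul _ h, trace_one]
  simp

theorem prj_step {i n : ℕ} (B : Matrix (Fin i) (Fin n) ℝ) (B' : Matrix (Fin (i + 1)) (Fin n) ℝ)
    (b : Fin n → ℝ) (h1 : ∀ k l, B' (Fin.castSucc k) l = B k l) (h2 : ∀ l, B' (Fin.last i) l = b l)
    (h : IsUnit (B * Bᵀ).det) (hs : b ⬝ᵥ (prj B *ᵥ b) ≠ 0) : IsUnit (B' * B'ᵀ).det := by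
  rw [isUnit_iff_ne_zero]
  intro h0
  obtain ⟨x, hx, hx0⟩ := exists_mulVec_eq_zero_iff.2 h0
  have e1 : (B'ᵀ *ᵥ x) = 0 := by
    rw [← dotProduct_self_eq_zero]
    have : x ⬝ᵥ ((B' * B'ᵀ) *ᵥ x) = 0 := by rw [hx0, dotProduct_zero]
    rwa [← mulVec_mulVec, dotProduct_mulVec, ← mulVec_transpose] at this
  have e2 : Bᵀ *ᵥ (fun k => x (Fin.castSucc k)) + x (Fin.last i) • b = 0 := by
    ext l
    have := congrFun e1 l
    simp only [mulVec, dotProduct, transpose_apply, Fin.sum_univ_castSucc, h1, h2,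
      Pi.zero_apply] at this
    simp only [mulVec, dotProduct, transpose_apply, Pi.add_apply, Pi.smul_apply, smul_eq_mul,
      Pi.zero_apply]
    linarith
  have e3 : x (Fin.last i) = 0 := by
    have := congrArg (fun z => b ⬝ᵥ (prj B *ᵥ z)) e2
    simp only [mulVec_add, mulVec_mulVec, prj_mul B h, zero_mulVec, zero_add, mulVec_smul,
      dotProduct_smul, mulVec_zero, dotProduct_zero, smul_eq_mul] at this
    exact (mul_eq_zero.1 this).resolve_right hs
  rw [e3, zero_smul, add_zero] at e2
  have e4 : (fun k => x (Fin.castSucc k)) = 0 := by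
    by_contra hne
    have : ∃ v ≠ 0, (B * Bᵀ) *ᵥ v = 0 := ⟨_, hne, by rw [← mulVec_mulVec, e2, mulVec_zero]⟩
    rw [exists_mulVec_eq_zero_iff] at this
    exact h.ne_zero this
  apply hx
  ext k
  refine Fin.lastCases e3 (fun j => ?_) k
  exact congrFun e4 j

theorem prj_update {i n : ℕ} (B : Matrix (Fin i) (Fin n) ℝ) (B' : Matrix (Fin (i + 1)) (Fin n) ℝ)
    (b : Fin n → ℝ) (h1 : ∀ k l, B' (Fin.castSucc k) l = B k l) (h2 : ∀ l, B' (Fin.last i) l = b l)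
    (h : IsUnit (B * Bᵀ).det) (hs : b ⬝ᵥ (prj B *ᵥ b) ≠ 0) :
    prj B' = prj B - (b ⬝ᵥ (prj B *ᵥ b))⁻¹ • vecMulVec (prj B *ᵥ b) (prj B *ᵥ b) := by
  have h' := prj_step B B' b h1 h2 h hs
  set s := b ⬝ᵥ (prj B *ᵥ b) with hsd
  set w := prj B *ᵥ b with hw
  set P' := prj B - s⁻¹ • vecMulVec w w with hP'
  have hBP := mul_prj B h
  have hBw : B *ᵥ w = 0 := by rw [hw, mulVec_mulVec, hBP, zero_mulVec]
  have hbw : b ᵥ* prj B = w := by rw [← mulVec_transpose, prj_sym]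
  have a1 : B * P' = 0 := by
    rw [hP', Matrix.mul_sub, hBP, Matrix.mul_smul, mul_vecMulVec, hBw, zero_vecMulVec]
    simp
  have a2 : b ᵥ* P' = 0 := by
    rw [hP', vecMul_sub, hbw, vecMul_smul, vecMul_vecMulVec, ← hsd, smul_smul, inv_mul_cancel₀ hs,
      one_smul, sub_self]
  have a3 : B' * P' = 0 := by
    ext k l
    refine Fin.lastCases ?_ (fun j => ?_) k
    · have := congrFun a2 l
      simpa only [Matrix.zero_apply, Pi.zero_apply, mul_apply, h2, vecMul, dotProduct] using this
    · have := congrFun (congrFun a1 j) l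
      simpa only [Matrix.zero_apply, Pi.zero_apply, mul_apply, h1] using this
  have b0 := prj_mul B' h'
  have b1 : prj B' * Bᵀ = 0 := by
    ext j k
    have := congrFun (congrFun b0 j) (Fin.castSucc k)
    simpa only [Matrix.zero_apply, Pi.zero_apply, mul_apply, transpose_apply, h1] using this
  have b2 : prj B' *ᵥ b = 0 := by
    ext j
    have := congrFun (congrFun b0 j) (Fin.last i)
    simpa only [Matrix.zero_apply, Pi.zero_apply, mul_apply, transpose_apply, h2, mulVec, dotProduct] using this
  have b3 : prj B' * prj B = prj B' := by
    conv_lhs => rw [prj.eq_1 B]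
    rw [Matrix.mul_sub, Matrix.mul_one, ← Matrix.mul_assoc, ← Matrix.mul_assoc, b1]
    simp
  have b4 : prj B' *ᵥ w = 0 := by rw [hw, mulVec_mulVec, b3, b2]
  have c1 : prj B' * P' = prj B' := by
    rw [hP', Matrix.mul_sub, b3, Matrix.mul_smul, mul_vecMulVec, b4, zero_vecMulVec]
    simp
  have c2 : prj B' * P' = P' := by
    conv_lhs => rw [prj.eq_1 B']
    rw [Matrix.sub_mul, Matrix.one_mul, Matrix.mul_assoc, a3, Matrix.mul_zero, sub_zero]
  rw [← c1, c2]

theorem measurable_det {α : Type*} [MeasurableSpace α] {i : ℕ}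
    {M : α → Matrix (Fin i) (Fin i) ℝ} (hM : ∀ k l, Measurable fun x => M x k l) :
    Measurable fun x => (M x).det := by
  simp only [det_apply]
  refine Finset.measurable_sum _ fun σ _ => Measurable.const_smul (Finset.measurable_prod _ fun k _ => hM _ _) _

theorem measurable_inv_entry {α : Type*} [MeasurableSpace α] {i : ℕ}
    {M : α → Matrix (Fin i) (Fin i) ℝ} (hM : ∀ k l, Measurable fun x => M x k l) (k l : Fin i) :
    Measurable fun x => (M x)⁻¹ k l := by
  simp only [inv_def, Ring.inverse_eq_inv', Matrix.smul_apply, smul_eq_mul, adjugate_apply]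
  refine (measurable_det hM).inv.mul (measurable_det fun a b => ?_)
  simp only [updateRow_apply]
  split_ifs
  · exact measurable_const
  · exact hM _ _

theorem measurable_mul_entry {α : Type*} [MeasurableSpace α] {i j k : ℕ}
    {M : α → Matrix (Fin i) (Fin j) ℝ} {N : α → Matrix (Fin j) (Fin k) ℝ}
    (hM : ∀ k l, Measurable fun x => M x k l)
    (hN : ∀ k l, Measurable fun x => N x k l) (a b) :
    Measurable fun x => (M x * N x) a b := by
  simp only [mul_apply]
  exact Finset.measurable_sum _ fun c _ => (hM _ _).mul (hN _ _)

theorem measurable_prj {α : Type*} [MeasurableSpace α] {i n : ℕ}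
    {B : α → Matrix (Fin i) (Fin n) ℝ} (hB : ∀ k l, Measurable fun x => B x k l) (k l : Fin n) :
    Measurable fun x => prj (B x) k l := by
  simp only [prj, Matrix.sub_apply]
  refine measurable_const.sub (measurable_mul_entry (measurable_mul_entry (fun a b => hB b a)
    (measurable_inv_entry (measurable_mul_entry hB fun a b => hB b a))) hB _ _)

section pm
variable {n p : ℕ} (a : Fin n → ℝ)

theorem measurable_uVec (i : ℕ) (l : Fin n) :
    Measurable fun ω : Fin p → Fin n → ℝ => uVec ω i l := by
  unfold uVec
  split_ifs with h
  · fun_prop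
  · exact measurable_const

theorem measurable_rowMat (i : ℕ) (k : Fin i) (l : Fin n) :
    Measurable fun ω : Fin p → Fin n → ℝ => rowMat (diagonal a) ω i k l := by
  simp only [rowMat, of_apply, mulVec_diagonal]
  exact (measurable_uVec _ _).const_mul _

theorem measurable_projMat (i : ℕ) (k l : Fin n) :
    Measurable fun ω : Fin p → Fin n → ℝ => projMat (diagonal a) ω i k l :=
  measurable_prj (fun k l => measurable_rowMat a i k l) k l

theorem uVec_update_self (ω : Fin p → Fin n → ℝ) (i : Fin p) (v : Fin n → ℝ) :
    uVec (Function.update ω i v) i = v := by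
  simp [uVec]

theorem uVec_update_ne (ω : Fin p → Fin n → ℝ) (i : Fin p) (v : Fin n → ℝ) (j : ℕ) (h : j ≠ i) :
    uVec (Function.update ω i v) j = uVec ω j := by
  unfold uVec
  split_ifs with hj
  · rw [Function.update_of_ne]
    intro h'; exact h (by rw [← h'])
  · rfl

theorem rowMat_update (A : Matrix (Fin n) (Fin n) ℝ) (ω : Fin p → Fin n → ℝ) (i : Fin p)
    (v : Fin n → ℝ) (j : ℕ) (h : j ≤ i) :
    rowMat A (Function.update ω i v) j = rowMat A ω j := by
  ext k l
  simp only [rowMat, of_apply]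
  rw [uVec_update_ne _ _ _ _ (by have := k.2; omega)]

theorem projMat_update (A : Matrix (Fin n) (Fin n) ℝ) (ω : Fin p → Fin n → ℝ) (i : Fin p)
    (v : Fin n → ℝ) (j : ℕ) (h : j ≤ i) :
    projMat A (Function.update ω i v) j = projMat A ω j := by
  unfold projMat; rw [rowMat_update _ _ _ _ _ h]

/-- nondegeneracy of the first `i` vectors -/
def nondeg (ω : Fin p → Fin n → ℝ) (i : ℕ) : Prop :=
  IsUnit (rowMat (diagonal a) ω i * (rowMat (diagonal a) ω i)ᵀ).det

theorem projMat_sym (ω : Fin p → Fin n → ℝ) (i : ℕ) :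
    (projMat (diagonal a) ω i)ᵀ = projMat (diagonal a) ω i := prj_sym _

theorem projMat_idem (ω : Fin p → Fin n → ℝ) (i : ℕ) :
    projMat (diagonal a) ω i * projMat (diagonal a) ω i = projMat (diagonal a) ω i := prj_idem _

variable {a}

theorem projMat_trace {ω : Fin p → Fin n → ℝ} {i : ℕ} (h : nondeg a ω i) :
    (projMat (diagonal a) ω i).trace = n - i := prj_trace _ h

theorem b_eq (P : Matrix (Fin n) (Fin n) ℝ) (u : Fin n → ℝ) :
    (diagonal a *ᵥ u) ⬝ᵥ (P *ᵥ (diagonal a *ᵥ u)) = qf (Mm a P) u := by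
  rw [qf, Mm, ← mulVec_mulVec, ← mulVec_mulVec, dotProduct_mulVec u, ← mulVec_transpose,
    diagonal_transpose]

theorem nondeg_step {ω : Fin p → Fin n → ℝ} {i : ℕ} (h : nondeg a ω i)
    (hs : qf (Mm a (projMat (diagonal a) ω i)) (uVec ω i) ≠ 0) : nondeg a ω (i + 1) := by
  refine prj_step (rowMat (diagonal a) ω i) _ (diagonal a *ᵥ uVec ω i) ?_ ?_ h ?_
  · intro k l; simp [rowMat]
  · intro l; simp [rowMat]
  · rw [← b_eq] at hs; exact hs

theorem Xs_step {ω : Fin p → Fin n → ℝ} {i : ℕ} (h : nondeg a ω i)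
    (hs : qf (Mm a (projMat (diagonal a) ω i)) (uVec ω i) ≠ 0) :
    Xs a (projMat (diagonal a) ω (i + 1)) = Xs a (projMat (diagonal a) ω i)
      - qr a (projMat (diagonal a) ω i) (uVec ω i) := by
  have h1 : projMat (diagonal a) ω (i + 1) = _ :=
    prj_update (rowMat (diagonal a) ω i) (rowMat (diagonal a) ω (i + 1)) (diagonal a *ᵥ uVec ω i)
      (fun k l => by simp [rowMat]) (fun l => by simp [rowMat]) h
      (by rw [← b_eq] at hs; exact hs)
  have h2 : prj (rowMat (diagonal a) ω i) = projMat (diagonal a) ω i := rfl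
  rw [h2, b_eq] at h1
  rw [h1, qr, qf_Nm (projMat_sym a ω i)]
  simp only [Xs, Matrix.sub_apply, Matrix.smul_apply, vecMulVec_apply, smul_eq_mul]
  rw [div_eq_mul_inv, Finset.sum_mul, ← Finset.sum_sub_distrib]
  exact Finset.sum_congr rfl fun k _ => by ring

theorem nondeg_zero (ω : Fin p → Fin n → ℝ) : nondeg a ω 0 := by
  simp [nondeg]

theorem projMat_zero (ω : Fin p → Fin n → ℝ) : projMat (diagonal a) ω 0 = 1 := by
  ext k l; simp [projMat]

end pm

open MeasureTheory ProbabilityTheory Matrix Filter Topology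

theorem measurable_upd {n p : ℕ} (i : Fin p) :
    Measurable fun z : (Fin p → Fin n → ℝ) × (Fin n → ℝ) => Function.update z.1 i z.2 := by
  refine measurable_pi_lambda _ fun j => ?_
  by_cases h : j = i
  · subst h; simp only [Function.update_self]; exact measurable_snd
  · simp only [Function.update_of_ne h]; fun_prop

theorem map_upd {n p : ℕ} (i : Fin p) :
    ((sphereLaw n p).prod (uniformSphere n)).map
      (fun z => Function.update z.1 i z.2) = sphereLaw n p := by
  symm
  refine Measure.pi_eq fun s hs => ?_
  rw [Measure.map_apply (measurable_upd i) (MeasurableSet.univ_pi hs)]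
  have : (fun z : (Fin p → Fin n → ℝ) × (Fin n → ℝ) => Function.update z.1 i z.2) ⁻¹'
      (Set.univ.pi s) = (Set.univ.pi (Function.update s i Set.univ)) ×ˢ (s i) := by
    ext ⟨ω, v⟩
    simp only [Set.mem_preimage, Set.mem_pi, Set.mem_univ, true_imp_iff, Set.mem_prod]
    constructor
    · intro h
      refine ⟨fun j => ?_, by simpa using h i⟩
      by_cases hj : j = i
      · subst hj; simp
      · simpa [Function.update_of_ne hj] using h j
    · rintro ⟨h1, h2⟩ j
      by_cases hj : j = i
      · subst hj; simpa using h2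
      · simpa [Function.update_of_ne hj] using h1 j
  rw [this, Measure.prod_prod, sphereLaw, Measure.pi_pi, ← Finset.mul_prod_erase _ _ (Finset.mem_univ i),
    ← Finset.mul_prod_erase _ (fun j => uniformSphere n (s j)) (Finset.mem_univ i)]
  simp only [Function.update_self, measure_univ, one_mul]
  rw [mul_comm]
  congr 1
  refine Finset.prod_congr rfl fun j hj => ?_
  rw [Function.update_of_ne (Finset.ne_of_mem_erase hj)]

theorem resample_integral {n p : ℕ} (i : Fin p) {E : Type*} [NormedAddCommGroup E] [NormedSpace ℝ E]
    {F : (Fin p → Fin n → ℝ) → E}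
    (hF : Integrable F (sphereLaw n p)) :
    ∫ ω, F ω ∂(sphereLaw n p)
      = ∫ ω, ∫ v, F (Function.update ω i v) ∂(uniformSphere n) ∂(sphereLaw n p) := by
  have hF' : Integrable F (((sphereLaw n p).prod (uniformSphere n)).map
      (fun z => Function.update z.1 i z.2)) := by rwa [map_upd]
  conv_lhs => rw [← map_upd i]
  rw [integral_map (measurable_upd i).aemeasurable hF'.1, integral_prod]
  exact (integrable_map_measure hF'.1 (measurable_upd i).aemeasurable).1 hF'

theorem resample_integrable {n p : ℕ} (i : Fin p) {E : Type*} [NormedAddCommGroup E]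
    [NormedSpace ℝ E] {F : (Fin p → Fin n → ℝ) → E}
    (hF : Integrable F (sphereLaw n p)) :
    Integrable (fun ω => ∫ v, F (Function.update ω i v) ∂(uniformSphere n)) (sphereLaw n p) := by
  have hF' : Integrable F (((sphereLaw n p).prod (uniformSphere n)).map
      (fun z => Function.update z.1 i z.2)) := by rwa [map_upd]
  exact ((integrable_map_measure hF'.1 (measurable_upd i).aemeasurable).1 hF').integral_prod_left

theorem resample_ae {n p : ℕ} (i : Fin p) {Q : (Fin p → Fin n → ℝ) → Prop}
    (hQ : MeasurableSet {ω | Q ω})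
    (h : ∀ᵐ ω ∂(sphereLaw n p), ∀ᵐ v ∂(uniformSphere n), Q (Function.update ω i v)) :
    ∀ᵐ ω ∂(sphereLaw n p), Q ω := by
  rw [← map_upd i, ae_map_iff (measurable_upd i).aemeasurable hQ]
  rw [Measure.ae_prod_iff_ae_ae]
  · exact h
  · exact measurable_upd i hQ

theorem resample_ae' {n p : ℕ} (i : Fin p) {Q : (Fin p → Fin n → ℝ) → Prop}
    (h : ∀ᵐ ω ∂(sphereLaw n p), Q ω) :
    ∀ᵐ ω ∂(sphereLaw n p), ∀ᵐ v ∂(uniformSphere n), Q (Function.update ω i v) := by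
  rw [← map_upd i] at h
  exact Measure.ae_ae_of_ae_prod (ae_of_ae_map (measurable_upd i).aemeasurable h)

section pm
variable {n p : ℕ} {a : Fin n → ℝ}

theorem measurable_qfP (i : ℕ) : Measurable fun ω : Fin p → Fin n → ℝ =>
    qf (Mm a (projMat (diagonal a) ω i)) (uVec ω i) := by
  simp only [qf_eq, Mm_apply]
  refine Finset.measurable_sum _ fun j _ => (measurable_uVec _ _).mul
    (Finset.measurable_sum _ fun k _ => ?_)
  exact (((measurable_projMat a i j k).const_mul _).mul_const _).mul (measurable_uVec _ _)

theorem measurable_Xs (i : ℕ) : Measurable fun ω : Fin p → Fin n → ℝ =>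
    Xs a (projMat (diagonal a) ω i) :=
  Finset.measurable_sum _ fun k _ => (measurable_projMat a i k k).const_mul _

theorem ae_nondeg {C : ℝ} (hC : 1 ≤ C) (haC : ∀ k, C⁻¹ ≤ a k ^ 2) (hp : p ≤ n) (i : ℕ) (hi : i ≤ p) :
    ∀ᵐ ω ∂(sphereLaw n p), nondeg a ω i := by
  induction i with
  | zero => exact ae_of_all _ nondeg_zero
  | succ i ih =>
    have hi' : i < p := hi
    have h1 := ih hi'.le
    have h2 : ∀ᵐ ω ∂(sphereLaw n p), qf (Mm a (projMat (diagonal a) ω i)) (uVec ω i) ≠ 0 := by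
      refine resample_ae ⟨i, hi'⟩ ((measurable_qfP i) (measurableSet_singleton 0).compl) ?_
      filter_upwards [h1] with ω hω
      have e1 : ∀ v, projMat (diagonal a) (Function.update ω (⟨i, hi'⟩ : Fin p) v) i
          = projMat (diagonal a) ω i := fun v => projMat_update _ _ _ _ _ le_rfl
      have e2 : ∀ v, uVec (Function.update ω (⟨i, hi'⟩ : Fin p) v) i = v := fun v =>
        uVec_update_self ω ⟨i, hi'⟩ v
      simp only [e1, e2]
      refine sphere_qf_ne _ (Mm_sym (projMat_sym a ω i))
        (qf_Mm_nonneg (projMat_sym a ω i) (projMat_idem a ω i)) ?_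
      refine lt_of_lt_of_le ?_ (Mm_trace_ge (projMat_sym a ω i) (projMat_idem a ω i) C haC)
      rw [projMat_trace hω]
      have : (i:ℝ) < n := by exact_mod_cast hi'.trans_le hp
      have hC0 : 0 < C := by linarith
      have : 0 < (n:ℝ) - i := by linarith
      positivity
    filter_upwards [h1, h2] with ω w1 w2 using nondeg_step w1 w2

theorem ae_Xs_step {C : ℝ} (hC : 1 ≤ C) (haC : ∀ k, C⁻¹ ≤ a k ^ 2) (hp : p ≤ n) (i : ℕ)
    (hi' : i < p) :
    ∀ᵐ ω ∂(sphereLaw n p), Xs a (projMat (diagonal a) ω (i + 1)) = Xs a (projMat (diagonal a) ω i)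
      - qr a (projMat (diagonal a) ω i) (uVec ω i) := by
  have h1 := ae_nondeg hC haC hp i hi'.le
  have h2 : ∀ᵐ ω ∂(sphereLaw n p), qf (Mm a (projMat (diagonal a) ω i)) (uVec ω i) ≠ 0 := by
    refine resample_ae ⟨i, hi'⟩ ((measurable_qfP i) (measurableSet_singleton 0).compl) ?_
    filter_upwards [h1] with ω hω
    have e1 : ∀ v, projMat (diagonal a) (Function.update ω (⟨i, hi'⟩ : Fin p) v) i
        = projMat (diagonal a) ω i := fun v => projMat_update _ _ _ _ _ le_rfl
    have e2 : ∀ v, uVec (Function.update ω (⟨i, hi'⟩ : Fin p) v) i = v := fun v =>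
      uVec_update_self ω ⟨i, hi'⟩ v
    simp only [e1, e2]
    refine sphere_qf_ne _ (Mm_sym (projMat_sym a ω i))
      (qf_Mm_nonneg (projMat_sym a ω i) (projMat_idem a ω i)) ?_
    refine lt_of_lt_of_le ?_ (Mm_trace_ge (projMat_sym a ω i) (projMat_idem a ω i) C haC)
    rw [projMat_trace hω]
    have : (i:ℝ) < n := by exact_mod_cast hi'.trans_le hp
    have hC0 : 0 < C := by linarith
    have : 0 < (n:ℝ) - i := by linarith
    positivity
  filter_upwards [h1, h2] with ω w1 w2 using Xs_step w1 w2

/-- crude bound -/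
theorem Xs_abs_le {δ : ℝ} (hδ0 : 0 ≤ δ) (hδ : ∑ k, dv a k ^ 2 ≤ δ ^ 2) (ω : Fin p → Fin n → ℝ) (i : ℕ) :
    |Xs a (projMat (diagonal a) ω i)| ≤ n * δ := by
  refine (Finset.abs_sum_le_sum_abs _ _).trans ?_
  calc _ ≤ ∑ _k : Fin n, δ := by
        refine Finset.sum_le_sum fun k _ => ?_
        rw [abs_mul]
        calc _ ≤ δ * 1 := mul_le_mul (dv_abs_le hδ0 hδ k)
              (proj_entry_le (projMat_sym a ω i) (projMat_idem a ω i) k k) (abs_nonneg _) hδ0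
          _ = δ := mul_one _
    _ = _ := by simp

theorem Xs_int {δ : ℝ} (hδ0 : 0 ≤ δ) (hδ : ∑ k, dv a k ^ 2 ≤ δ ^ 2) (i : ℕ) :
    Integrable (fun ω : Fin p → Fin n → ℝ => Xs a (projMat (diagonal a) ω i)) (sphereLaw n p) :=
  integrable_bdd (measurable_Xs i) _ (ae_of_all _ fun ω => Xs_abs_le hδ0 hδ ω i)

theorem Xs_sq_int {δ : ℝ} (hδ0 : 0 ≤ δ) (hδ : ∑ k, dv a k ^ 2 ≤ δ ^ 2) (i : ℕ) :
    Integrable (fun ω : Fin p → Fin n → ℝ => Xs a (projMat (diagonal a) ω i) ^ 2)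
      (sphereLaw n p) := by
  refine integrable_bdd ((measurable_Xs i).pow_const 2) ((n * δ) ^ 2) (ae_of_all _ fun ω => ?_)
  rw [abs_pow]; exact pow_le_pow_left₀ (abs_nonneg _) (Xs_abs_le hδ0 hδ ω i) 2

theorem Xs_second (hn : 0 < n) (hp : p ≤ n) {δ : ℝ} (hδ0 : 0 < δ) (hδ1 : δ ≤ 1)
    (hδ : ∑ k, dv a k ^ 2 ≤ δ ^ 2) (hd0 : ∑ k, dv a k = 0) {C c : ℝ} (hC : 1 ≤ C)
    (haC : ∀ k, C⁻¹ ≤ a k ^ 2 ∧ a k ^ 2 ≤ C)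
    (hc : 0 < c) (hcp : c * n ≤ n - p) (i : ℕ) (hi : i ≤ p) :
    1 + ∫ ω, Xs a (projMat (diagonal a) ω i) ^ 2 ∂(sphereLaw n p)
      ≤ (1 + stepK C (C⁻¹ * c) * (δ / n)) ^ i := by
  have hn' : (0:ℝ) < n := by exact_mod_cast hn
  have hC0 : 0 < C := by linarith
  have hK : 0 ≤ stepK C (C⁻¹ * c) := by unfold stepK; positivity
  induction i with
  | zero =>
    have : Xs a (1 : Matrix (Fin n) (Fin n) ℝ) = 0 := by simp [Xs, hd0]
    simp [projMat_zero, this]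
  | succ i ih =>
    have hi' : i < p := hi
    have ih := ih hi'.le
    have h1 : ∫ ω, Xs a (projMat (diagonal a) ω (i + 1)) ^ 2 ∂(sphereLaw n p) =
        ∫ ω, ∫ v, (Xs a (projMat (diagonal a) ω i) - qr a (projMat (diagonal a) ω i) v) ^ 2
          ∂(uniformSphere n) ∂(sphereLaw n p) := by
      rw [resample_integral ⟨i, hi'⟩ (Xs_sq_int hδ0.le hδ (i + 1))]
      refine integral_congr_ae ?_
      filter_upwards [resample_ae' ⟨i, hi'⟩ (ae_Xs_step hC (fun k => (haC k).1) hp i hi')] with ω hω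
      refine integral_congr_ae ?_
      filter_upwards [hω] with v hv
      rw [hv, projMat_update _ _ _ _ _ le_rfl, uVec_update_self ω ⟨i, hi'⟩ v]
    have h2 : ∫ ω, ∫ v, (Xs a (projMat (diagonal a) ω i) - qr a (projMat (diagonal a) ω i) v) ^ 2
          ∂(uniformSphere n) ∂(sphereLaw n p) ≤
        ∫ ω, (Xs a (projMat (diagonal a) ω i) ^ 2 + stepK C (C⁻¹ * c) * (δ / n) *
          (1 + Xs a (projMat (diagonal a) ω i) ^ 2)) ∂(sphereLaw n p) := by
      refine integral_mono_of_nonneg (ae_of_all _ fun ω => integral_nonneg fun v => sq_nonneg _)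
        ((Xs_sq_int hδ0.le hδ i).add (((integrable_const _).add (Xs_sq_int hδ0.le hδ i)).const_mul _)) ?_
      filter_upwards [ae_nondeg hC (fun k => (haC k).1) hp i hi'.le] with ω hω
      have hip : (i:ℝ) ≤ p := by exact_mod_cast hi'.le
      have ht := projMat_trace hω
      refine step_bound hn (projMat_sym a ω i) (projMat_idem a ω i) hδ0 hδ1 hδ hC
        (fun k => (haC k).2) (by positivity) ?_ ?_
      · refine le_trans ?_ (Mm_trace_ge (projMat_sym a ω i) (projMat_idem a ω i) C fun k => (haC k).1)
        rw [ht, mul_assoc]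
        gcongr
        linarith
      · rw [ht]; linarith [(Nat.cast_nonneg i : (0:ℝ) ≤ i)]
    have h3 : ∫ ω, (Xs a (projMat (diagonal a) ω i) ^ 2 + stepK C (C⁻¹ * c) * (δ / n) *
          (1 + Xs a (projMat (diagonal a) ω i) ^ 2)) ∂(sphereLaw n p)
        = ∫ ω, Xs a (projMat (diagonal a) ω i) ^ 2 ∂(sphereLaw n p) +
          stepK C (C⁻¹ * c) * (δ / n) *
          (1 + ∫ ω, Xs a (projMat (diagonal a) ω i) ^ 2 ∂(sphereLaw n p)) := by
      have hIntg : Integrable (fun ω : Fin p → Fin n → ℝ =>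
        1 + Xs a (projMat (diagonal a) ω i) ^ 2) (sphereLaw n p) :=
        (integrable_const _).add (Xs_sq_int hδ0.le hδ i)
      rw [integral_add (Xs_sq_int hδ0.le hδ i) (hIntg.const_mul _), integral_const_mul,
        integral_add (integrable_const _) (Xs_sq_int hδ0.le hδ i)]
      simp
    rw [pow_succ]
    have h4 : 0 ≤ stepK C (C⁻¹ * c) * (δ / n) := by positivity
    nlinarith [mul_le_mul_of_nonneg_right ih (by linarith : 0 ≤ 1 + stepK C (C⁻¹ * c) * (δ / n))]

theorem Xs_second' (hn : 0 < n) (hp : p ≤ n) {δ : ℝ} (hδ0 : 0 < δ) (hδ1 : δ ≤ 1)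
    (hδ : ∑ k, dv a k ^ 2 ≤ δ ^ 2) (hd0 : ∑ k, dv a k = 0) {C c : ℝ} (hC : 1 ≤ C)
    (haC : ∀ k, C⁻¹ ≤ a k ^ 2 ∧ a k ^ 2 ≤ C)
    (hc : 0 < c) (hcp : c * n ≤ n - p) (i : ℕ) (hi : i ≤ p) :
    ∫ ω, Xs a (projMat (diagonal a) ω i) ^ 2 ∂(sphereLaw n p)
      ≤ Real.exp (stepK C (C⁻¹ * c) * δ) - 1 := by
  have h := Xs_second hn hp hδ0 hδ1 hδ hd0 hC haC hc hcp i hi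
  have hn' : (0:ℝ) < n := by exact_mod_cast hn
  have hC0 : 0 < C := by linarith
  have hK : 0 ≤ stepK C (C⁻¹ * c) := by unfold stepK; positivity
  have h1 : (1 + stepK C (C⁻¹ * c) * (δ / n)) ^ i ≤ Real.exp (stepK C (C⁻¹ * c) * δ) := by
    have e : 1 + stepK C (C⁻¹ * c) * (δ / n) ≤ Real.exp (stepK C (C⁻¹ * c) * (δ / n)) := by
      linarith [Real.add_one_le_exp (stepK C (C⁻¹ * c) * (δ / n))]
    refine (pow_le_pow_left₀ (by positivity) e i).trans ?_
    rw [← Real.exp_nat_mul, Real.exp_le_exp]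
    have hin : (i:ℝ) ≤ n := by exact_mod_cast hi.trans hp
    calc i * (stepK C (C⁻¹ * c) * (δ / n)) ≤ n * (stepK C (C⁻¹ * c) * (δ / n)) := by gcongr
      _ = _ := by field_simp
  linarith

end pm

open MeasureTheory ProbabilityTheory Matrix Filter Topology

theorem exp_taylor (x : ℝ) :
    ‖Complex.exp (x * Complex.I) - (1 + x * Complex.I - (x:ℂ) ^ 2 / 2)‖ ≤ 4 * |x| ^ 3 := by
  have hnorm : ‖(x * Complex.I : ℂ)‖ = |x| := by simp
  by_cases h : |x| ≤ 1
  · have := Complex.exp_bound (x := x * Complex.I) (by rw [hnorm]; exact h) (n := 3) (by norm_num)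
    have e : ∑ m ∈ Finset.range 3, (x * Complex.I : ℂ) ^ m / (m.factorial : ℂ)
        = 1 + x * Complex.I - (x:ℂ) ^ 2 / 2 := by
      simp [Finset.sum_range_succ, mul_pow, Nat.factorial]
      ring
    rw [e, hnorm] at this
    refine this.trans ?_
    rw [mul_comm]
    gcongr
    norm_num [Nat.factorial]
  · push Not at h
    have h1 : ‖Complex.exp (x * Complex.I)‖ = 1 := Complex.norm_exp_ofReal_mul_I x
    have h2 : ‖(1 + x * Complex.I - (x:ℂ) ^ 2 / 2)‖ ≤ 1 + |x| + |x| ^ 2 / 2 := by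
      refine (norm_sub_le _ _).trans (add_le_add ((norm_add_le _ _).trans ?_) ?_)
      · rw [hnorm]; simp
      · simp
    refine (norm_sub_le _ _).trans ?_
    rw [h1]
    have h3 : |x| ≤ |x| ^ 3 := le_self_pow₀ h.le (by norm_num)
    have h4 : |x| ^ 2 ≤ |x| ^ 3 := pow_le_pow_right₀ h.le (by norm_num)
    linarith

theorem exp_neg_approx (y : ℝ) (hy : 0 ≤ y) : |1 - y - Real.exp (-y)| ≤ y ^ 2 := by
  have h1 : 1 - y ≤ Real.exp (-y) := by linarith [Real.add_one_le_exp (-y)]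
  have h2 : Real.exp (-y) ≤ 1 - y + y ^ 2 := by
    rw [Real.exp_neg]
    have : 1 + y ≤ Real.exp y := by linarith [Real.add_one_le_exp y]
    refine (inv_anti₀ (by linarith) this).trans ?_
    rw [inv_le_iff_one_le_mul₀ (by linarith)]
    nlinarith [pow_nonneg hy 3]
  rw [abs_le]; constructor <;> nlinarith

theorem cube_le (x η : ℝ) (hη : 0 < η) : |x| ^ 3 ≤ η * x ^ 2 + x ^ 4 / η := by
  have e : η * x ^ 2 + x ^ 4 / η - |x| ^ 3 = ((|x| * η) ^ 2 - (|x| * η) * |x| ^ 2 + (|x| ^ 2) ^ 2) / η := by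
    rw [← sq_abs x, show x ^ 4 = |x| ^ 4 from by rw [Even.pow_abs (by decide)]]
    field_simp
    ring
  have : 0 ≤ ((|x| * η) ^ 2 - (|x| * η) * |x| ^ 2 + (|x| ^ 2) ^ 2) / η := by
    apply div_nonneg _ hη.le
    nlinarith [sq_nonneg (|x| * η - |x| ^ 2), sq_nonneg (|x| * η), sq_nonneg (|x| ^ 2)]
  linarith

theorem int_bdd {α E : Type*} [MeasurableSpace α] [NormedAddCommGroup E] {μ : Measure α}
    [IsFiniteMeasure μ] {F : α → E} (hF : AEStronglyMeasurable F μ) (K : ℝ) (h : ∀ x, ‖F x‖ ≤ K) :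
    Integrable F μ := Integrable.of_bound hF K (ae_of_all _ h)

theorem char_step {α : Type*} [MeasurableSpace α] (ν : Measure α) [IsProbabilityMeasure ν]
    (Y : α → ℝ) (hY : Measurable Y) (B : ℝ) (hB : ∀ᵐ v ∂ν, |Y v| ≤ B)
    (V B4 s η τ : ℝ) (h1 : ∫ v, Y v ∂ν = 0) (h2 : ∫ v, Y v ^ 2 ∂ν = V)
    (h4 : ∫ v, Y v ^ 4 ∂ν ≤ B4) (hs : 0 ≤ s) (hη : 0 < η) :
    ‖∫ v, Complex.exp ((τ * Y v : ℝ) * Complex.I) ∂ν - (Real.exp (-(τ ^ 2 * s / 2)) : ℂ)‖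
      ≤ 4 * |τ| ^ 3 * (η * V + B4 / η) + τ ^ 2 * |V - s| / 2 + (τ ^ 2 * s / 2) ^ 2 := by
  have i1 : Integrable Y ν := integrable_bdd hY B hB
  have ip : ∀ k, Integrable (fun v => Y v ^ k) ν := fun k => by
    refine integrable_bdd (hY.pow_const k) (B ^ k) ?_
    filter_upwards [hB] with v hv
    rw [abs_pow]; exact pow_le_pow_left₀ (abs_nonneg _) hv k
  have iexp : Integrable (fun v => Complex.exp ((τ * Y v : ℝ) * Complex.I)) ν := by
    refine int_bdd (by fun_prop) 1 fun v => ?_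
    rw [Complex.norm_exp_ofReal_mul_I]
  have ipoly : Integrable (fun v => (1 + (τ * Y v : ℝ) * Complex.I - ((τ * Y v : ℝ):ℂ) ^ 2 / 2)) ν := by
    refine Integrable.sub (Integrable.add (integrable_const _) ?_) ?_
    · exact ((i1.const_mul τ).ofReal).mul_const _
    · have := (((ip 2).const_mul (τ ^ 2)).ofReal (𝕜 := ℂ)).div_const 2
      refine this.congr (ae_of_all _ fun v => ?_)
      simp [mul_pow]
  have ev : ∫ v, (1 + (τ * Y v : ℝ) * Complex.I - ((τ * Y v : ℝ):ℂ) ^ 2 / 2) ∂ν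
      = ((1 - τ ^ 2 * V / 2 : ℝ) : ℂ) := by
    have e1 : ∫ v, ((1:ℂ) + (τ * Y v : ℝ) * Complex.I) ∂ν = 1 := by
      rw [integral_add (integrable_const _) (((i1.const_mul τ).ofReal).mul_const _),
        integral_mul_const, integral_complex_ofReal, integral_const_mul, h1]
      simp
    have e2 : ∫ v, ((τ * Y v : ℝ):ℂ) ^ 2 / 2 ∂ν = ((τ ^ 2 * V / 2 : ℝ) : ℂ) := by
      have : (fun v => ((τ * Y v : ℝ):ℂ) ^ 2 / 2) = fun v => ((τ ^ 2 / 2 * Y v ^ 2 : ℝ) : ℂ) := by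
        ext v; push_cast; ring
      rw [this, integral_complex_ofReal, integral_const_mul, h2]
      push_cast; ring
    have i2 : Integrable (fun v => ((τ * Y v : ℝ):ℂ) ^ 2 / 2) ν := by
      have := (((ip 2).const_mul (τ ^ 2)).ofReal (𝕜 := ℂ)).div_const 2
      refine this.congr (ae_of_all _ fun v => ?_)
      simp [mul_pow]
    have i3 : Integrable (fun v => (1:ℂ) + (τ * Y v : ℝ) * Complex.I) ν :=
      (integrable_const _).add (((i1.const_mul τ).ofReal).mul_const _)
    rw [integral_sub i3 i2, e1, e2]
    push_cast; ring
  have b1 : ‖∫ v, Complex.exp ((τ * Y v : ℝ) * Complex.I) ∂ν - ((1 - τ ^ 2 * V / 2 : ℝ) : ℂ)‖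
      ≤ 4 * |τ| ^ 3 * (η * V + B4 / η) := by
    rw [← ev, ← integral_sub iexp ipoly]
    have hi : Integrable (fun v => 4 * |τ| ^ 3 * (η * Y v ^ 2 + Y v ^ 4 / η)) ν :=
      (((ip 2).const_mul _).add ((ip 4).div_const _)).const_mul _
    refine (norm_integral_le_of_norm_le hi (ae_of_all _ fun v => ?_)).trans ?_
    · refine (exp_taylor _).trans ?_
      rw [abs_mul, mul_pow, ← mul_assoc]
      gcongr
      exact cube_le _ _ hη
    · rw [integral_const_mul, integral_add ((ip 2).const_mul _) ((ip 4).div_const _),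
        integral_const_mul, integral_div, h2]
      gcongr
  have b2 : ‖((1 - τ ^ 2 * V / 2 : ℝ) : ℂ) - (Real.exp (-(τ ^ 2 * s / 2)) : ℂ)‖
      ≤ τ ^ 2 * |V - s| / 2 + (τ ^ 2 * s / 2) ^ 2 := by
    rw [← Complex.ofReal_sub, Complex.norm_real, Real.norm_eq_abs]
    have := exp_neg_approx (τ ^ 2 * s / 2) (by positivity)
    have e : 1 - τ ^ 2 * V / 2 - Real.exp (-(τ ^ 2 * s / 2)) = -(τ ^ 2 * (V - s) / 2)
      + (1 - τ ^ 2 * s / 2 - Real.exp (-(τ ^ 2 * s / 2))) := by ring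
    rw [e]
    refine (abs_add_le _ _).trans (add_le_add ?_ this)
    rw [abs_neg, abs_div, abs_mul, abs_of_nonneg (sq_nonneg τ)]
    simp
  calc _ ≤ _ := norm_sub_le_norm_sub_add_norm_sub _ ((1 - τ ^ 2 * V / 2 : ℝ) : ℂ) _
    _ ≤ _ := add_le_add b1 b2
    _ = _ := by ring

open MeasureTheory ProbabilityTheory Matrix Filter Topology

theorem var_num {n r κ m t1 t2 T : ℝ} (hr : 1 ≤ r) (hrn : r ^ 2 = n) (hκ : 0 < κ)
    (hm : κ * n ≤ m) (hmn : m ≤ n) (h1 : |t1 - m| ≤ r) (h2 : |t2 - m| ≤ 3 * r) (h3 : |T - m| ≤ r)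
    (hT : κ * n ≤ T) :
    |(2 * n * t2 - 2 * t1 ^ 2) / (n + 2) / T ^ 2 - (2 / m - 2 / n)|
      ≤ (20 / κ ^ 2 + 6 / κ ^ 3) * (r / n ^ 2) := by
  have hn : 1 ≤ n := by rw [← hrn]; exact one_le_pow₀ hr
  have hrn' : r ≤ n := by rw [← hrn]; exact le_self_pow₀ hr (by norm_num)
  have hn0 : 0 < n := by linarith
  have hm0 : 0 < m := lt_of_lt_of_le (by positivity) hm
  have hT0 : 0 < T := lt_of_lt_of_le (by positivity) hT
  set N := (2 * n * t2 - 2 * t1 ^ 2) / (n + 2) with hN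
  set N' := (2 * n * m - 2 * m ^ 2) / n with hN'
  have e1 : 2 / m - 2 / n = N' / m ^ 2 := by rw [hN']; field_simp
  have t1b : |t1 ^ 2 - m ^ 2| ≤ 3 * n * r := by
    have : t1 ^ 2 - m ^ 2 = (t1 - m) * (t1 + m) := by ring
    rw [this, abs_mul, mul_comm]
    have : |t1 + m| ≤ 3 * n := by
      rw [abs_le] at h1 ⊢; constructor <;> linarith
    exact mul_le_mul this h1 (abs_nonneg _) (by positivity)
  have Tb : |m ^ 2 - T ^ 2| ≤ 3 * n * r := by
    have : m ^ 2 - T ^ 2 = -((T - m) * (T + m)) := by ring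
    rw [this, abs_neg, abs_mul, mul_comm]
    have : |T + m| ≤ 3 * n := by
      rw [abs_le] at h3 ⊢; constructor <;> linarith
    exact mul_le_mul this h3 (abs_nonneg _) (by positivity)
  have hNN : |N - N'| ≤ 20 * r := by
    have e2 : N - N' = 2 * n / (n + 2) * (t2 - m) - 4 * m / (n + 2) - 2 / (n + 2) * (t1 ^ 2 - m ^ 2)
        + 4 * m ^ 2 / (n * (n + 2)) := by
      rw [hN, hN']; field_simp; ring
    have a1 : |2 * n / (n + 2) * (t2 - m)| ≤ 6 * r := by
      rw [abs_mul, abs_of_pos (by positivity)]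
      have : 2 * n / (n + 2) ≤ 2 := by rw [div_le_iff₀ (by positivity)]; linarith
      nlinarith [abs_nonneg (t2 - m)]
    have a2 : |4 * m / (n + 2)| ≤ 4 * r := by
      rw [abs_of_pos (by positivity), div_le_iff₀ (by positivity)]; nlinarith
    have a3 : |2 / (n + 2) * (t1 ^ 2 - m ^ 2)| ≤ 6 * r := by
      rw [abs_mul, abs_of_pos (by positivity)]
      have : 2 / (n + 2) ≤ 2 / n := by gcongr; linarith
      calc _ ≤ 2 / n * (3 * n * r) := by gcongr
        _ = _ := by field_simp; ring
    have a4 : |4 * m ^ 2 / (n * (n + 2))| ≤ 4 * r := by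
      rw [abs_of_pos (by positivity), div_le_iff₀ (by positivity)]
      have : m ^ 2 ≤ n ^ 2 := by gcongr
      have : 0 ≤ (r - 1) * (n * (n + 2)) := mul_nonneg (by linarith) (by positivity)
      nlinarith
    rw [e2]
    calc _ ≤ |2 * n / (n + 2) * (t2 - m)| + |4 * m / (n + 2)| + |2 / (n + 2) * (t1 ^ 2 - m ^ 2)|
        + |4 * m ^ 2 / (n * (n + 2))| :=
          (abs_add_le _ _).trans (add_le_add_left ((abs_sub _ _).trans
            (add_le_add_left (abs_sub _ _) _)) _)
      _ ≤ _ := by linarith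
  have hN'0 : |N'| ≤ 2 * m := by
    rw [hN', abs_le]
    constructor
    · rw [le_div_iff₀ hn0]; nlinarith
    · rw [div_le_iff₀ hn0]; nlinarith [sq_nonneg m]
  have e3 : N / T ^ 2 - N' / m ^ 2 = (N - N') / T ^ 2 + N' * (m ^ 2 - T ^ 2) / (m ^ 2 * T ^ 2) := by
    field_simp; ring
  have hT2 : κ ^ 2 * n ^ 2 ≤ T ^ 2 := by rw [← mul_pow]; gcongr
  rw [e1, e3]
  have c1 : |(N - N') / T ^ 2| ≤ 20 / κ ^ 2 * (r / n ^ 2) := by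
    rw [abs_div, abs_of_pos (by positivity : 0 < T ^ 2)]
    calc _ ≤ 20 * r / (κ ^ 2 * n ^ 2) := by gcongr
      _ = _ := by field_simp
  have c2 : |N' * (m ^ 2 - T ^ 2) / (m ^ 2 * T ^ 2)| ≤ 6 / κ ^ 3 * (r / n ^ 2) := by
    rw [abs_div, abs_mul, abs_of_pos (by positivity : 0 < m ^ 2 * T ^ 2)]
    calc _ ≤ (2 * m) * (3 * n * r) / (m ^ 2 * (κ ^ 2 * n ^ 2)) := by gcongr
      _ = 6 * r / (m * κ ^ 2 * n) := by field_simp; ring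
      _ ≤ 6 * r / ((κ * n) * κ ^ 2 * n) := by gcongr
      _ = _ := by field_simp
  calc _ ≤ _ := abs_add_le _ _
    _ ≤ _ := add_le_add c1 c2
    _ = _ := by ring

/-- the standing assumptions for fixed `n` -/
structure Stp (n p : ℕ) (a : Fin n → ℝ) (δ C c : ℝ) : Prop where
  hn : 0 < n
  hp : p ≤ n
  hδ0 : 0 < δ
  hδ1 : δ ≤ 1
  hδ : ∑ k, dv a k ^ 2 ≤ δ ^ 2
  hd0 : ∑ k, dv a k = 0
  hC : 1 ≤ C
  haC : ∀ k, C⁻¹ ≤ a k ^ 2 ∧ a k ^ 2 ≤ C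
  hc : 0 < c
  hcp : c * n ≤ n - p

/-- `A P_i A` -/
noncomputable def MM {n p : ℕ} (a : Fin n → ℝ) (ω : Fin p → Fin n → ℝ) (i : ℕ) :
    Matrix (Fin n) (Fin n) ℝ := Mm a (projMat (diagonal a) ω i)

/-- conditional variance -/
noncomputable def Vv {n p : ℕ} (a : Fin n → ℝ) (ω : Fin p → Fin n → ℝ) (i : ℕ) : ℝ :=
  (2 * n * (MM a ω i * MM a ω i).trace - 2 * (MM a ω i).trace ^ 2) / (n + 2)
    / Tstat n p (diagonal a) i ^ 2

namespace Stp
variable {n p : ℕ} {a : Fin n → ℝ} {δ C c : ℝ}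

theorem n0 (S : Stp n p a δ C c) : (0:ℝ) < n := by exact_mod_cast S.hn
theorem C0 (S : Stp n p a δ C c) : 0 < C := by linarith [S.hC]
theorem κ0 (S : Stp n p a δ C c) : 0 < C⁻¹ * c := mul_pos (inv_pos.2 S.C0) S.hc
theorem r1 (S : Stp n p a δ C c) : 1 ≤ Real.sqrt n := by
  rw [Real.one_le_sqrt]; exact_mod_cast S.hn
theorem r2 (S : Stp n p a δ C c) : Real.sqrt n ^ 2 = n := Real.sq_sqrt S.n0.le

theorem κle (S : Stp n p a δ C c) {i : ℕ} (hi : i ≤ p) : C⁻¹ * c * n ≤ (n:ℝ) - i := by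
  have hip : (i:ℝ) ≤ p := by exact_mod_cast hi
  have h1 : C⁻¹ ≤ 1 := inv_le_one_of_one_le₀ S.hC
  have h2 : 0 ≤ c * n := (mul_pos S.hc S.n0).le
  have := S.hcp
  rw [mul_assoc]
  nlinarith

theorem ae_nd (S : Stp n p a δ C c) (i : ℕ) (hi : i ≤ p) : ∀ᵐ ω ∂(sphereLaw n p), nondeg a ω i :=
  ae_nondeg S.hC (fun k => (S.haC k).1) S.hp i hi

theorem Xint (S : Stp n p a δ C c) (i : ℕ) : Integrable (fun ω : Fin p → Fin n → ℝ =>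
    Xs a (projMat (diagonal a) ω i)) (sphereLaw n p) := Xs_int S.hδ0.le S.hδ i

theorem Xabs (S : Stp n p a δ C c) {i : ℕ} (ω : Fin p → Fin n → ℝ) (h : nondeg a ω i) :
    |Xs a (projMat (diagonal a) ω i)| ≤ Real.sqrt n := by
  have h1 := Xs_sq_le (projMat_sym a ω i) (projMat_idem a ω i) S.hδ
  rw [projMat_trace h] at h1
  apply abs_le_of_sq_le_sq _ (Real.sqrt_nonneg _)
  rw [S.r2]
  have : δ ^ 2 ≤ 1 := pow_le_one₀ S.hδ0.le S.hδ1
  have h3 : (0:ℝ) ≤ i := Nat.cast_nonneg i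
  nlinarith [sq_nonneg δ, S.n0]

theorem MM_tr (S : Stp n p a δ C c) {i : ℕ} (ω : Fin p → Fin n → ℝ) (h : nondeg a ω i) :
    (MM a ω i).trace = n - i + Xs a (projMat (diagonal a) ω i) := by
  rw [MM, Mm_trace, projMat_trace h]

theorem T_eq (S : Stp n p a δ C c) {i : ℕ} (hi : i ≤ p) : Tstat n p (diagonal a) i
    = n - i + ∫ ω, Xs a (projMat (diagonal a) ω i) ∂(sphereLaw n p) := by
  have hIntg : ∀ k l, Integrable (fun ω : Fin p → Fin n → ℝ => projMat (diagonal a) ω i k l)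
      (sphereLaw n p) := fun k l =>
    integrable_bdd (measurable_projMat a i k l) 1 (ae_of_all _ fun ω =>
      proj_entry_le (projMat_sym a ω i) (projMat_idem a ω i) k l)
  have h1 : Tstat n p (diagonal a) i = ∫ ω, (MM a ω i).trace ∂(sphereLaw n p) := by
    simp only [Tstat, trace, diag_apply, diagonal_mul_diagonal, diagonal_mul, meanProj, of_apply,
      MM, Mm_apply]
    rw [integral_finsetSum]
    · refine Finset.sum_congr rfl fun k _ => ?_
      rw [← integral_const_mul]
      congr 1; ext ω; ring
    · intro k _
      exact ((hIntg k k).const_mul _).mul_const _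
  have h2 : ∫ ω, (MM a ω i).trace ∂(sphereLaw n p) = 
      ∫ ω, (((n:ℝ) - i) + Xs a (projMat (diagonal a) ω i)) ∂(sphereLaw n p) := by
    refine integral_congr_ae ?_
    filter_upwards [S.ae_nd i hi] with ω hω using S.MM_tr ω hω
  rw [h1, h2, integral_add (integrable_const _) (S.Xint i)]
  simp

theorem T_ge (S : Stp n p a δ C c) {i : ℕ} (hi : i ≤ p) : C⁻¹ * c * n ≤ Tstat n p (diagonal a) i := by
  have h1 : ∀ᵐ ω ∂(sphereLaw n p), C⁻¹ * c * n - (n - i) ≤ Xs a (projMat (diagonal a) ω i) := by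
    filter_upwards [S.ae_nd i hi] with ω hω
    have h1 := Mm_trace_ge (projMat_sym a ω i) (projMat_idem a ω i) C fun k => (S.haC k).1
    have h2 := S.MM_tr ω hω
    rw [MM] at h2
    rw [projMat_trace hω, h2] at h1
    have hip : (i:ℝ) ≤ p := by exact_mod_cast hi
    have : C⁻¹ * (c * n) ≤ C⁻¹ * (n - i) :=
      mul_le_mul_of_nonneg_left (by linarith [S.hcp]) (inv_pos.2 S.C0).le
    linarith
  have h2 := integral_mono_ae (integrable_const _) (S.Xint i) h1
  rw [S.T_eq hi]
  simp at h2
  linarith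

theorem T0 (S : Stp n p a δ C c) {i : ℕ} (hi : i ≤ p) : 0 < Tstat n p (diagonal a) i :=
  lt_of_lt_of_le (mul_pos S.κ0 S.n0) (S.T_ge hi)

theorem T_abs (S : Stp n p a δ C c) {i : ℕ} (hi : i ≤ p) : |Tstat n p (diagonal a) i - (n - i)| ≤ Real.sqrt n := by
  rw [S.T_eq hi, add_sub_cancel_left]
  have : ‖∫ ω, Xs a (projMat (diagonal a) ω i) ∂(sphereLaw n p)‖ ≤ Real.sqrt n * (sphereLaw n p).real Set.univ := by
    refine norm_integral_le_of_norm_le_const ?_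
    filter_upwards [S.ae_nd i hi] with ω hω using S.Xabs ω hω
  simpa using this

theorem V_abs (S : Stp n p a δ C c) {i : ℕ} (hi : i ≤ p) (ω : Fin p → Fin n → ℝ) (h : nondeg a ω i) :
    |Vv a ω i - (2 / (n - i) - 2 / n)|
      ≤ (20 / (C⁻¹ * c) ^ 2 + 6 / (C⁻¹ * c) ^ 3) * (Real.sqrt n / n ^ 2) := by
  have hX := S.Xabs ω h
  refine var_num S.r1 S.r2 S.κ0 (S.κle hi) (by linarith [(Nat.cast_nonneg i : (0:ℝ) ≤ i)]) ?_ ?_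
    (S.T_abs hi) (S.T_ge hi)
  · rw [S.MM_tr ω h, add_sub_cancel_left]; exact hX
  · rw [MM, Mm_trace2 (projMat_sym a ω i) (projMat_idem a ω i), projMat_trace h]
    have hY := Ys_le (projMat_sym a ω i) (projMat_idem a ω i) S.hδ
    have hY0 := Ys_nonneg (a := a) (projMat_sym a ω i) (projMat_idem a ω i)
    have : δ ^ 2 ≤ 1 := pow_le_one₀ S.hδ0.le S.hδ1
    have := S.r1
    rw [abs_le] at hX ⊢
    constructor <;> linarith

theorem V_le (S : Stp n p a δ C c) {i : ℕ} (hi : i ≤ p) (ω : Fin p → Fin n → ℝ) (h : nondeg a ω i) :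
    Vv a ω i ≤ 2 * C ^ 2 / (C⁻¹ * c) ^ 2 * (1 / n) := by
  have h1 := Mm_trace2_le (projMat_sym a ω i) (projMat_idem a ω i) C fun k => (S.haC k).2
  have hn := S.n0
  have hκ := S.κ0
  rw [projMat_trace h] at h1
  have h2 : (MM a ω i * MM a ω i).trace ≤ C ^ 2 * n := h1.trans (by
    gcongr; linarith [(Nat.cast_nonneg i : (0:ℝ) ≤ i)])
  have hC := S.C0
  have h3 : (2 * n * (MM a ω i * MM a ω i).trace - 2 * (MM a ω i).trace ^ 2) / (n + 2)
      ≤ 2 * C ^ 2 * n := by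
    rw [div_le_iff₀ (by positivity)]
    have := mul_le_mul_of_nonneg_left h2 hn.le
    nlinarith [sq_nonneg (MM a ω i).trace, mul_pos (by positivity : (0:ℝ) < C^2) hn]
  unfold Vv
  calc _ ≤ 2 * C ^ 2 * n / Tstat n p (diagonal a) i ^ 2 := by gcongr
    _ ≤ 2 * C ^ 2 * n / (C⁻¹ * c * n) ^ 2 := by
      gcongr; exact S.T_ge hi
    _ = _ := by generalize C⁻¹ * c = κ at *; field_simp

end Stp

open MeasureTheory ProbabilityTheory Matrix Filter Topology

/-- martingale differences -/
noncomputable def Wd {n p : ℕ} (a : Fin n → ℝ) (ω : Fin p → Fin n → ℝ) (i : ℕ) : ℝ :=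
  (n * qf (MM a ω i) (uVec ω i) - (MM a ω i).trace) / Tstat n p (diagonal a) i

theorem measurable_MMtr {n p : ℕ} {a : Fin n → ℝ} (i : ℕ) :
    Measurable fun ω : Fin p → Fin n → ℝ => (MM a ω i).trace := by
  simp only [MM, trace, diag_apply, Mm_apply]
  exact Finset.measurable_sum _ fun k _ => ((measurable_projMat a i k k).const_mul _).mul_const _

theorem measurable_Wd {n p : ℕ} {a : Fin n → ℝ} (i : ℕ) :
    Measurable fun ω : Fin p → Fin n → ℝ => Wd a ω i :=
  (((measurable_qfP i).const_mul _).sub (measurable_MMtr i)).div_const _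

theorem MM_update {n p : ℕ} {a : Fin n → ℝ} (ω : Fin p → Fin n → ℝ) (k : Fin p) (v : Fin n → ℝ)
    (i : ℕ) (h : i ≤ k) : MM a (Function.update ω k v) i = MM a ω i := by
  unfold MM; rw [projMat_update _ _ _ _ _ h]

theorem Wd_update_lt {n p : ℕ} {a : Fin n → ℝ} (ω : Fin p → Fin n → ℝ) (k : Fin p) (v : Fin n → ℝ)
    (i : ℕ) (h : i < k) : Wd a (Function.update ω k v) i = Wd a ω i := by
  unfold Wd; rw [MM_update _ _ _ _ h.le, uVec_update_ne _ _ _ _ h.ne]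

theorem Wd_update_self {n p : ℕ} {a : Fin n → ℝ} (ω : Fin p → Fin n → ℝ) (k : Fin p) (v : Fin n → ℝ) :
    Wd a (Function.update ω k v) k = (n * qf (MM a ω k) v - (MM a ω k).trace)
      / Tstat n p (diagonal a) k := by
  unfold Wd; rw [MM_update _ _ _ _ le_rfl, uVec_update_self]

/-- error constant -/
noncomputable def errK (C κ τ : ℝ) : ℝ :=
  4 * |τ| ^ 3 * (2 * C ^ 2 / κ ^ 2 + 16 * gK * C ^ 4 / κ ^ 4)
    + τ ^ 2 * (20 / κ ^ 2 + 6 / κ ^ 3) / 2 + τ ^ 4 / κ ^ 2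

/-- limiting variance of a step -/
noncomputable def sv (n i : ℕ) : ℝ := 2 / ((n:ℝ) - i) - 2 / n

namespace Stp
variable {n p : ℕ} {a : Fin n → ℝ} {δ C c : ℝ}

theorem sv0 (S : Stp n p a δ C c) {i : ℕ} (hi : i ≤ p) : 0 ≤ sv n i := by
  have h1 := S.κle hi
  have h2 : 0 < (n:ℝ) - i := lt_of_lt_of_le (mul_pos S.κ0 S.n0) h1
  have h3 : (0:ℝ) ≤ i := Nat.cast_nonneg i
  unfold sv
  rw [sub_nonneg]
  gcongr
  linarith

theorem sv_le (S : Stp n p a δ C c) {i : ℕ} (hi : i ≤ p) : sv n i ≤ 2 / (C⁻¹ * c * n) := by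
  have h1 := S.κle hi
  have h0 := mul_pos S.κ0 S.n0
  have h2 : 0 < (n:ℝ) - i := lt_of_lt_of_le h0 h1
  have := S.n0
  unfold sv
  have : (2:ℝ) / (n - i) ≤ 2 / (C⁻¹ * c * n) := by gcongr
  have : 0 < (2:ℝ) / n := by positivity
  linarith

theorem char_inner (S : Stp n p a δ C c) (τ : ℝ) {i : ℕ} (hi : i ≤ p) (ω : Fin p → Fin n → ℝ) (h : nondeg a ω i) :
    ‖∫ v, Complex.exp ((τ * ((n * qf (MM a ω i) v - (MM a ω i).trace)
      / Tstat n p (diagonal a) i) : ℝ) * Complex.I) ∂(uniformSphere n)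
      - (Real.exp (-(τ ^ 2 * sv n i / 2)) : ℂ)‖ ≤ errK C (C⁻¹ * c) τ * (Real.sqrt n / n ^ 2) := by
  set T := Tstat n p (diagonal a) i with hT
  set M := MM a ω i with hM
  have hT0 : 0 < T := S.T0 hi
  have hTge : C⁻¹ * c * n ≤ T := S.T_ge hi
  have hMs : Mᵀ = M := Mm_sym (projMat_sym a ω i)
  have hr := S.r1
  have hr2 := S.r2
  have hn := S.n0
  have hκ := S.κ0
  have hC := S.C0
  have hgK := gK_nonneg
  set r := Real.sqrt n with hrd
  have hr0 : 0 < r := by linarith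
  have hmeas : Measurable fun v => (n * qf M v - M.trace) / T :=
    (((measurable_qf M).const_mul _).sub_const _).div_const _
  have hbd : ∀ᵐ v ∂(uniformSphere n), |(n * qf M v - M.trace) / T|
      ≤ (n * (∑ j, ∑ k, |M j k|) + |M.trace|) / T := by
    filter_upwards [sphere_qf_bdd M] with v hv
    rw [abs_div, abs_of_pos hT0]
    gcongr
    refine (abs_sub _ _).trans ?_
    rw [abs_mul, Nat.abs_cast]
    gcongr
  have m1 : ∫ v, (n * qf M v - M.trace) / T ∂(uniformSphere n) = 0 := by
    rw [integral_div, integral_sub (sphere_qf_int M) (integrable_const _), sphere_qf_m1 S.hn M hMs]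
    simp
  have m2 : ∫ v, ((n * qf M v - M.trace) / T) ^ 2 ∂(uniformSphere n) = Vv a ω i := by
    simp only [div_pow]
    rw [integral_div, sphere_qf_c S.hn M hMs, sub_self]
    simp [Vv, hM, hT]
  have m4 : ∫ v, ((n * qf M v - M.trace) / T) ^ 4 ∂(uniformSphere n)
      ≤ 16 * gK * C ^ 4 / (C⁻¹ * c) ^ 4 * (1 / n ^ 2) := by
    simp only [div_pow]
    rw [integral_div]
    have h1 := sphere_qf_m4 S.hn M hMs C (qf_Mm_nonneg (projMat_sym a ω i) (projMat_idem a ω i))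
      (qf_Mm_le (projMat_sym a ω i) (projMat_idem a ω i) C fun k => (S.haC k).2)
    calc _ ≤ 16 * gK * C ^ 4 * n ^ 2 / T ^ 4 := by gcongr
      _ ≤ 16 * gK * C ^ 4 * n ^ 2 / (C⁻¹ * c * n) ^ 4 := by gcongr
      _ = _ := by generalize C⁻¹ * c = κ at *; field_simp
  have key := char_step (uniformSphere n) _ hmeas _ hbd (Vv a ω i) _ (sv n i) (r / n) τ m1 m2 m4
    (S.sv0 hi) (by positivity)
  refine key.trans ?_
  have hV := S.V_abs hi ω h
  have hV2 := S.V_le hi ω h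
  have hs := S.sv_le hi
  have hs0 := S.sv0 hi
  have g1 : r / n * Vv a ω i ≤ 2 * C ^ 2 / (C⁻¹ * c) ^ 2 * (r / n ^ 2) := by
    calc _ ≤ r / n * (2 * C ^ 2 / (C⁻¹ * c) ^ 2 * (1 / n)) := by gcongr
      _ = _ := by generalize C⁻¹ * c = κ at *; field_simp
  have g2 : 16 * gK * C ^ 4 / (C⁻¹ * c) ^ 4 * (1 / n ^ 2) / (r / n)
      = 16 * gK * C ^ 4 / (C⁻¹ * c) ^ 4 * (r / n ^ 2) := by
    generalize C⁻¹ * c = κ at *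
    field_simp
    rw [hr2]
  have g3 : (τ ^ 2 * sv n i / 2) ^ 2 ≤ τ ^ 4 / (C⁻¹ * c) ^ 2 * (r / n ^ 2) := by
    calc _ ≤ (τ ^ 2 * (2 / (C⁻¹ * c * n)) / 2) ^ 2 := by gcongr
      _ = τ ^ 4 / (C⁻¹ * c) ^ 2 * (1 / n ^ 2) := by
        generalize C⁻¹ * c = κ at *; field_simp
      _ ≤ _ := by gcongr
  have g4 : τ ^ 2 * |Vv a ω i - sv n i| / 2
      ≤ τ ^ 2 * (20 / (C⁻¹ * c) ^ 2 + 6 / (C⁻¹ * c) ^ 3) / 2 * (r / n ^ 2) := by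
    calc _ ≤ τ ^ 2 * ((20 / (C⁻¹ * c) ^ 2 + 6 / (C⁻¹ * c) ^ 3) * (r / n ^ 2)) / 2 := by
          gcongr; exact hV
      _ = _ := by ring
  have g5 : 4 * |τ| ^ 3 * (r / n * Vv a ω i + 16 * gK * C ^ 4 / (C⁻¹ * c) ^ 4 * (1 / n ^ 2) / (r / n))
      ≤ 4 * |τ| ^ 3 * (2 * C ^ 2 / (C⁻¹ * c) ^ 2 + 16 * gK * C ^ 4 / (C⁻¹ * c) ^ 4) * (r / n ^ 2) := by
    rw [g2]
    calc _ ≤ 4 * |τ| ^ 3 * (2 * C ^ 2 / (C⁻¹ * c) ^ 2 * (r / n ^ 2)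
          + 16 * gK * C ^ 4 / (C⁻¹ * c) ^ 4 * (r / n ^ 2)) := by gcongr
      _ = _ := by ring
  have : errK C (C⁻¹ * c) τ * (r / n ^ 2) =
    4 * |τ| ^ 3 * (2 * C ^ 2 / (C⁻¹ * c) ^ 2 + 16 * gK * C ^ 4 / (C⁻¹ * c) ^ 4) * (r / n ^ 2)
    + τ ^ 2 * (20 / (C⁻¹ * c) ^ 2 + 6 / (C⁻¹ * c) ^ 3) / 2 * (r / n ^ 2)
    + τ ^ 4 / (C⁻¹ * c) ^ 2 * (r / n ^ 2) := by unfold errK; ring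
  linarith

theorem char_int (τ : ℝ) (k : ℕ) : Integrable (fun ω : Fin p → Fin n → ℝ =>
    Complex.exp ((τ * ∑ i ∈ Finset.range k, Wd a ω i : ℝ) * Complex.I)) (sphereLaw n p) := by
  refine int_bdd ?_ 1 fun ω => ?_
  · have : Measurable fun ω : Fin p → Fin n → ℝ => τ * ∑ i ∈ Finset.range k, Wd a ω i :=
      (Finset.measurable_sum _ fun i _ => measurable_Wd i).const_mul _
    exact (Complex.measurable_exp.comp
      ((Complex.measurable_ofReal.comp this).mul_const _)).aestronglyMeasurable
  · rw [Complex.norm_exp_ofReal_mul_I]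

theorem char_tel (S : Stp n p a δ C c) (τ : ℝ) (k : ℕ) (hk : k ≤ p) :
    ‖∫ ω, Complex.exp ((τ * ∑ i ∈ Finset.range k, Wd a ω i : ℝ) * Complex.I) ∂(sphereLaw n p)
      - (Real.exp (-(τ ^ 2 * (∑ i ∈ Finset.range k, sv n i) / 2)) : ℂ)‖
      ≤ k * (errK C (C⁻¹ * c) τ * (Real.sqrt n / n ^ 2)) := by
  induction k with
  | zero => simp
  | succ k ih =>
    have hk' : k < p := hk
    have ih := ih hk'.le
    set Er := errK C (C⁻¹ * c) τ * (Real.sqrt n / n ^ 2) with hEr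
    set F := fun ω : Fin p → Fin n → ℝ =>
      Complex.exp ((τ * ∑ i ∈ Finset.range k, Wd a ω i : ℝ) * Complex.I) with hF
    set g := fun ω : Fin p → Fin n → ℝ =>
      ∫ v, Complex.exp ((τ * ((n * qf (MM a ω k) v - (MM a ω k).trace)
        / Tstat n p (diagonal a) k) : ℝ) * Complex.I) ∂(uniformSphere n) with hg
    have hupd : ∀ ω : Fin p → Fin n → ℝ, ∫ v, Complex.exp ((τ * ∑ i ∈ Finset.range (k + 1),
        Wd a (Function.update ω ⟨k, hk'⟩ v) i : ℝ) * Complex.I) ∂(uniformSphere n) = F ω * g ω := by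
      intro ω
      rw [hF, hg]
      simp only
      rw [← integral_const_mul]
      congr 1; ext v
      rw [Finset.sum_range_succ, Wd_update_self ω ⟨k, hk'⟩ v, ← Complex.exp_add]
      congr 1
      rw [Finset.sum_congr rfl fun i hi => Wd_update_lt ω ⟨k, hk'⟩ v i (Finset.mem_range.1 hi)]
      push_cast; ring
    have h1 : ∫ ω, Complex.exp ((τ * ∑ i ∈ Finset.range (k + 1), Wd a ω i : ℝ) * Complex.I)
        ∂(sphereLaw n p) = ∫ ω, F ω * g ω ∂(sphereLaw n p) := by
      rw [resample_integral ⟨k, hk'⟩ (char_int τ (k + 1))]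
      exact integral_congr_ae (ae_of_all _ hupd)
    have hIntg : Integrable (fun ω => F ω * g ω) (sphereLaw n p) :=
      (resample_integrable ⟨k, hk'⟩ (char_int τ (k + 1))).congr (ae_of_all _ hupd)
    set e := (Real.exp (-(τ ^ 2 * sv n k / 2)) : ℂ) with he
    have h2 : ‖∫ ω, F ω * g ω ∂(sphereLaw n p) - e * ∫ ω, F ω ∂(sphereLaw n p)‖ ≤ Er := by
      rw [← integral_const_mul, ← integral_sub hIntg ((char_int τ k).const_mul e)]
      have : ‖∫ ω, (F ω * g ω - e * F ω) ∂(sphereLaw n p)‖ ≤ Er * (sphereLaw n p).real Set.univ := by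
        refine norm_integral_le_of_norm_le_const ?_
        filter_upwards [S.ae_nd k hk'.le] with ω hω
        have : F ω * g ω - e * F ω = F ω * (g ω - e) := by ring
        rw [this, norm_mul, hF]
        simp only
        rw [Complex.norm_exp_ofReal_mul_I, one_mul]
        exact S.char_inner τ hk'.le ω hω
      rw [probReal_univ, mul_one] at this
      exact this
    have h3 : (Real.exp (-(τ ^ 2 * (∑ i ∈ Finset.range (k + 1), sv n i) / 2)) : ℂ)
        = e * (Real.exp (-(τ ^ 2 * (∑ i ∈ Finset.range k, sv n i) / 2)) : ℂ) := by
      rw [he, ← Complex.ofReal_mul, ← Real.exp_add, Finset.sum_range_succ]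
      congr 2; ring
    have he1 : ‖e‖ ≤ 1 := by
      rw [he, Complex.norm_real, Real.norm_eq_abs, Real.abs_exp, Real.exp_le_one_iff]
      have := S.sv0 hk'.le
      have : 0 ≤ τ ^ 2 * sv n k / 2 := by positivity
      linarith
    rw [h1, h3]
    set φ := ∫ ω, F ω ∂(sphereLaw n p)
    calc _ ≤ _ := norm_sub_le_norm_sub_add_norm_sub _ (e * φ) _
      _ ≤ Er + k * Er := by
        refine add_le_add h2 ?_
        rw [← mul_sub, norm_mul]
        calc _ ≤ 1 * _ := mul_le_mul_of_nonneg_right he1 (norm_nonneg _)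
          _ ≤ _ := by rw [one_mul]; exact ih
      _ = _ := by push_cast; ring

end Stp

open MeasureTheory ProbabilityTheory Matrix Filter Topology

/-- remainder -/
noncomputable def Rd {n p : ℕ} (a : Fin n → ℝ) (ω : Fin p → Fin n → ℝ) (i : ℕ) : ℝ :=
  ((MM a ω i).trace - Tstat n p (diagonal a) i) / Tstat n p (diagonal a) i

theorem measurable_Rd {n p : ℕ} {a : Fin n → ℝ} (i : ℕ) :
    Measurable fun ω : Fin p → Fin n → ℝ => Rd a ω i :=
  ((measurable_MMtr i).sub_const _).div_const _

theorem abs_int_le_sqrt {α : Type*} [MeasurableSpace α] (μ : Measure α) [IsProbabilityMeasure μ]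
    (f : α → ℝ) (h1 : Integrable f μ) (h2 : Integrable (fun x => f x ^ 2) μ) {B : ℝ}
    (hB : ∫ x, f x ^ 2 ∂μ ≤ B ^ 2) (hB0 : 0 ≤ B) : ∫ x, |f x| ∂μ ≤ B := by
  set m := ∫ x, |f x| ∂μ with hm
  have h3 : 0 ≤ ∫ x, (|f x| - m) ^ 2 ∂μ := integral_nonneg fun x => sq_nonneg _
  have e : (fun x => (|f x| - m) ^ 2) = fun x => (f x ^ 2 - 2 * m * |f x|) + m ^ 2 := by
    ext x; rw [sub_sq, sq_abs]; ring
  have i3 : Integrable (fun x => f x ^ 2 - 2 * m * |f x|) μ := h2.sub (h1.abs.const_mul _)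
  rw [e, integral_add i3 (integrable_const _), integral_sub h2 (h1.abs.const_mul _),
    integral_const_mul, ← hm] at h3
  simp at h3
  exact le_of_sq_le_sq (by nlinarith) hB0

theorem exp_lip (x y : ℝ) :
    ‖Complex.exp (x * Complex.I) - Complex.exp (y * Complex.I)‖ ≤ |x - y| := by
  have : Complex.exp (x * Complex.I) - Complex.exp (y * Complex.I)
      = Complex.exp (y * Complex.I) * (Complex.exp (Complex.I * (x - y : ℝ)) - 1) := by
    rw [mul_sub, ← Complex.exp_add, mul_one]
    congr 2; push_cast; ring
  rw [this, norm_mul, Complex.norm_exp_ofReal_mul_I, one_mul]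
  exact Real.norm_exp_I_mul_ofReal_sub_one_le

/-- bound on the second moment of the remainder -/
noncomputable def epsK (C κ δ : ℝ) : ℝ := Real.exp (stepK C κ * δ) - 1

namespace Stp
variable {n p : ℕ} {a : Fin n → ℝ} {δ C c : ℝ}

theorem eps0 (S : Stp n p a δ C c) : 0 ≤ epsK C (C⁻¹ * c) δ := by
  have hC := S.C0
  have hκ := S.κ0
  have hδ := S.hδ0
  have : 0 ≤ stepK C (C⁻¹ * c) := by unfold stepK; positivity
  unfold epsK
  rw [sub_nonneg]
  exact Real.one_le_exp (by positivity)

theorem Z_eq (S : Stp n p a δ C c) {i : ℕ} (hi : i ≤ p) (ω : Fin p → Fin n → ℝ) : Ztil (diagonal a) ω i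
    = (n * qf (MM a ω i) (uVec ω i) - Tstat n p (diagonal a) i) / Tstat n p (diagonal a) i := by
  have := (S.T0 hi).ne'
  unfold Ztil Qmat
  rw [smul_mulVec, dotProduct_smul, smul_eq_mul]
  have : uVec ω i ⬝ᵥ (diagonal a * projMat (diagonal a) ω i * diagonal a) *ᵥ uVec ω i
    = qf (MM a ω i) (uVec ω i) := rfl
  rw [this]
  field_simp

theorem Z_split (S : Stp n p a δ C c) {i : ℕ} (hi : i ≤ p) (ω : Fin p → Fin n → ℝ) :
    Ztil (diagonal a) ω i = Wd a ω i + Rd a ω i := by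
  rw [S.Z_eq hi, Wd, Rd, ← add_div]; congr 1; ring

theorem Z_meas (S : Stp n p a δ C c) {i : ℕ} (hi : i ≤ p) :
    Measurable fun ω : Fin p → Fin n → ℝ => Ztil (diagonal a) ω i := by
  have : (fun ω : Fin p → Fin n → ℝ => Ztil (diagonal a) ω i) = fun ω => Wd a ω i + Rd a ω i :=
    funext (S.Z_split hi)
  rw [this]
  exact (measurable_Wd i).add (measurable_Rd i)

theorem u_norm (S : Stp n p a δ C c) {i : ℕ} (hi : i < p) : ∀ᵐ ω ∂(sphereLaw n p), uVec ω i ⬝ᵥ uVec ω i = 1 := by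
  refine resample_ae ⟨i, hi⟩ ?_ ?_
  · refine measurableSet_eq_fun ?_ measurable_const
    simp only [dotProduct]
    exact Finset.measurable_sum _ fun k _ => (measurable_uVec i k).mul (measurable_uVec i k)
  · refine ae_of_all _ fun ω => ?_
    filter_upwards [sphere_norm S.hn] with v hv
    rw [uVec_update_self ω ⟨i, hi⟩ v, ← hv]
    exact Finset.sum_congr rfl fun k _ => by ring

theorem Z_bdd (S : Stp n p a δ C c) {i : ℕ} (hi : i < p) : ∀ᵐ ω ∂(sphereLaw n p), |Ztil (diagonal a) ω i|
    ≤ (n * C + Tstat n p (diagonal a) i) / Tstat n p (diagonal a) i := by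
  filter_upwards [S.u_norm hi] with ω hω
  have hT := S.T0 hi.le
  have h1 : qf (MM a ω i) (uVec ω i) ≤ C * (uVec ω i ⬝ᵥ uVec ω i) :=
    qf_Mm_le (projMat_sym a ω i) (projMat_idem a ω i) C (fun k => (S.haC k).2) (uVec ω i)
  have h0 : 0 ≤ qf (MM a ω i) (uVec ω i) := qf_Mm_nonneg (a := a) (projMat_sym a ω i) (projMat_idem a ω i) (uVec ω i)
  rw [hω, mul_one] at h1
  have hn := S.n0
  rw [S.Z_eq hi.le, abs_div, abs_of_pos hT]
  gcongr
  refine (abs_sub _ _).trans ?_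
  rw [abs_of_pos hT, abs_of_nonneg (mul_nonneg hn.le h0)]
  gcongr

theorem Z_sq_int (S : Stp n p a δ C c) {i : ℕ} (hi : i < p) :
    Integrable (fun ω : Fin p → Fin n → ℝ => Ztil (diagonal a) ω i ^ 2) (sphereLaw n p) := by
  refine integrable_bdd ((S.Z_meas hi.le).pow_const 2)
    (((n * C + Tstat n p (diagonal a) i) / Tstat n p (diagonal a) i) ^ 2) ?_
  filter_upwards [S.Z_bdd hi] with ω hω
  rw [abs_pow]
  exact pow_le_pow_left₀ (abs_nonneg _) hω 2

theorem R_eq (S : Stp n p a δ C c) {i : ℕ} (hi : i ≤ p) (ω : Fin p → Fin n → ℝ) (h : nondeg a ω i) :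
    Rd a ω i = (Xs a (projMat (diagonal a) ω i)
      - ∫ ω', Xs a (projMat (diagonal a) ω' i) ∂(sphereLaw n p)) / Tstat n p (diagonal a) i := by
  have h1 := S.T_eq hi
  rw [Rd, S.MM_tr ω h]
  congr 1
  linarith

theorem R_ae_bdd (S : Stp n p a δ C c) {i : ℕ} (hi : i ≤ p) : ∀ᵐ ω ∂(sphereLaw n p), |Rd a ω i|
    ≤ (2 * Real.sqrt n) / Tstat n p (diagonal a) i := by
  filter_upwards [S.ae_nd i hi] with ω hω
  have hT := S.T0 hi
  rw [Rd, abs_div, abs_of_pos hT]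
  gcongr
  have h1 := S.T_abs hi
  have h2 := S.Xabs ω hω
  rw [S.MM_tr ω hω]
  rw [abs_le] at *
  constructor <;> linarith

theorem R_int (S : Stp n p a δ C c) {i : ℕ} (hi : i ≤ p) :
    Integrable (fun ω : Fin p → Fin n → ℝ => Rd a ω i) (sphereLaw n p) :=
  integrable_bdd (measurable_Rd i) _ (S.R_ae_bdd hi)

theorem R_sq_int (S : Stp n p a δ C c) {i : ℕ} (hi : i ≤ p) :
    Integrable (fun ω : Fin p → Fin n → ℝ => Rd a ω i ^ 2) (sphereLaw n p) := by
  refine integrable_bdd ((measurable_Rd i).pow_const 2)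
    (((2 * Real.sqrt n) / Tstat n p (diagonal a) i) ^ 2) ?_
  filter_upwards [S.R_ae_bdd hi] with ω hω
  rw [abs_pow]
  exact pow_le_pow_left₀ (abs_nonneg _) hω 2

theorem R_sq (S : Stp n p a δ C c) {i : ℕ} (hi : i ≤ p) : ∫ ω, Rd a ω i ^ 2 ∂(sphereLaw n p)
    ≤ epsK C (C⁻¹ * c) δ / (C⁻¹ * c * n) ^ 2 := by
  have hT := S.T0 hi
  have hε := S.eps0
  set m := ∫ ω', Xs a (projMat (diagonal a) ω' i) ∂(sphereLaw n p) with hm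
  have h1 : ∫ ω, Rd a ω i ^ 2 ∂(sphereLaw n p) = (∫ ω, (Xs a (projMat (diagonal a) ω i) - m) ^ 2
      ∂(sphereLaw n p)) / Tstat n p (diagonal a) i ^ 2 := by
    rw [← integral_div]
    refine integral_congr_ae ?_
    filter_upwards [S.ae_nd i hi] with ω hω
    rw [S.R_eq hi ω hω, div_pow]
  have i2 := Xs_sq_int (p := p) S.hδ0.le S.hδ i
  have h2 : ∫ ω, (Xs a (projMat (diagonal a) ω i) - m) ^ 2 ∂(sphereLaw n p)
      ≤ epsK C (C⁻¹ * c) δ := by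
    have e : (fun ω : Fin p → Fin n → ℝ => (Xs a (projMat (diagonal a) ω i) - m) ^ 2)
      = fun ω => (Xs a (projMat (diagonal a) ω i) ^ 2 - 2 * m * Xs a (projMat (diagonal a) ω i))
        + m ^ 2 := by ext ω; ring
    have i3 : Integrable (fun ω : Fin p → Fin n → ℝ => Xs a (projMat (diagonal a) ω i) ^ 2
      - 2 * m * Xs a (projMat (diagonal a) ω i)) (sphereLaw n p) := i2.sub ((S.Xint i).const_mul _)
    rw [e, integral_add i3 (integrable_const _), integral_sub i2 ((S.Xint i).const_mul _),
      integral_const_mul, ← hm]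
    have := Xs_second' S.hn S.hp S.hδ0 S.hδ1 S.hδ S.hd0 S.hC S.haC S.hc S.hcp i hi
    simp
    unfold epsK
    nlinarith [sq_nonneg m]
  rw [h1]
  have := mul_pos S.κ0 S.n0
  have := S.T_ge hi
  gcongr

theorem R_abs (S : Stp n p a δ C c) {i : ℕ} (hi : i ≤ p) : ∫ ω, |Rd a ω i| ∂(sphereLaw n p)
    ≤ Real.sqrt (epsK C (C⁻¹ * c) δ) / (C⁻¹ * c * n) := by
  have := mul_pos S.κ0 S.n0
  refine abs_int_le_sqrt _ _ (S.R_int hi) (S.R_sq_int hi) ?_ (by positivity)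
  rw [div_pow, Real.sq_sqrt S.eps0]
  exact S.R_sq hi

theorem Z_sq (S : Stp n p a δ C c) {i : ℕ} (hi : i < p) :
    |∫ ω, Ztil (diagonal a) ω i ^ 2 ∂(sphereLaw n p) - sv n i|
      ≤ (20 / (C⁻¹ * c) ^ 2 + 6 / (C⁻¹ * c) ^ 3) * (Real.sqrt n / n ^ 2)
        + epsK C (C⁻¹ * c) δ / (C⁻¹ * c * n) ^ 2 := by
  have hT := S.T0 hi.le
  have inner : ∀ ω : Fin p → Fin n → ℝ, ∫ v, Ztil (diagonal a) (Function.update ω ⟨i, hi⟩ v) i ^ 2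
      ∂(uniformSphere n) = Vv a ω i + Rd a ω i ^ 2 := by
    intro ω
    have : ∀ v, Ztil (diagonal a) (Function.update ω ⟨i, hi⟩ v) i ^ 2
        = (n * qf (MM a ω i) v - Tstat n p (diagonal a) i) ^ 2 / Tstat n p (diagonal a) i ^ 2 := by
      intro v
      rw [S.Z_eq hi.le, MM_update ω ⟨i, hi⟩ v i le_rfl, uVec_update_self ω ⟨i, hi⟩ v, div_pow]
    simp only [this]
    rw [integral_div, sphere_qf_c S.hn (MM a ω i) (Mm_sym (projMat_sym a ω i)), add_div, Vv, Rd, div_pow]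
  have hVR : Integrable (fun ω => Vv a ω i + Rd a ω i ^ 2) (sphereLaw n p) :=
    (resample_integrable ⟨i, hi⟩ (S.Z_sq_int hi)).congr (ae_of_all _ inner)
  have hV : Integrable (fun ω => Vv a ω i) (sphereLaw n p) := by
    refine (hVR.sub (S.R_sq_int hi.le)).congr (ae_of_all _ fun ω => ?_)
    simp
  have h1 : ∫ ω, Ztil (diagonal a) ω i ^ 2 ∂(sphereLaw n p)
      = ∫ ω, Vv a ω i ∂(sphereLaw n p) + ∫ ω, Rd a ω i ^ 2 ∂(sphereLaw n p) := by
    rw [resample_integral ⟨i, hi⟩ (S.Z_sq_int hi), ← integral_add hV (S.R_sq_int hi.le)]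
    exact integral_congr_ae (ae_of_all _ inner)
  have h2 : |∫ ω, Vv a ω i ∂(sphereLaw n p) - sv n i|
      ≤ (20 / (C⁻¹ * c) ^ 2 + 6 / (C⁻¹ * c) ^ 3) * (Real.sqrt n / n ^ 2) := by
    have e : ∫ ω, Vv a ω i ∂(sphereLaw n p) - sv n i = ∫ ω, (Vv a ω i - sv n i) ∂(sphereLaw n p) := by
      rw [integral_sub hV (integrable_const _)]; simp
    rw [e]
    have : ‖∫ ω, (Vv a ω i - sv n i) ∂(sphereLaw n p)‖
      ≤ ((20 / (C⁻¹ * c) ^ 2 + 6 / (C⁻¹ * c) ^ 3) * (Real.sqrt n / n ^ 2))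
        * (sphereLaw n p).real Set.univ := by
      refine norm_integral_le_of_norm_le_const ?_
      filter_upwards [S.ae_nd i hi.le] with ω hω using S.V_abs hi.le ω hω
    rwa [probReal_univ, mul_one] at this
  have h3 := S.R_sq hi.le
  have h4 : 0 ≤ ∫ ω, Rd a ω i ^ 2 ∂(sphereLaw n p) := integral_nonneg fun _ => sq_nonneg _
  rw [h1, add_sub_right_comm]
  refine (abs_add_le _ _).trans (add_le_add h2 ?_)
  rwa [abs_of_nonneg h4]

theorem sum_le (S : Stp n p a δ C c) {b x : ℝ} {f : ℕ → ℝ} (hb : 0 ≤ b) (h : ∀ i < p, f i ≤ b) (hx : n * b = x) :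
    ∑ i ∈ Finset.range p, f i ≤ x := by
  have hpn : (p:ℝ) ≤ n := by exact_mod_cast S.hp
  calc _ ≤ ∑ i ∈ Finset.range p, b := Finset.sum_le_sum fun i hi => h i (Finset.mem_range.1 hi)
    _ = p * b := by simp
    _ ≤ n * b := by gcongr
    _ = x := hx

theorem sigma_close (S : Stp n p a δ C c) :
    |∑ i ∈ Finset.range p, ∫ ω, Ztil (diagonal a) ω i ^ 2 ∂(sphereLaw n p)
      - ∑ i ∈ Finset.range p, sv n i|
      ≤ (20 / (C⁻¹ * c) ^ 2 + 6 / (C⁻¹ * c) ^ 3) * (Real.sqrt n / n)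
        + epsK C (C⁻¹ * c) δ / (C⁻¹ * c) ^ 2 * (1 / n) := by
  have hκ := S.κ0
  have hn := S.n0
  have hε := S.eps0
  rw [← Finset.sum_sub_distrib]
  refine (Finset.abs_sum_le_sum_abs _ _).trans (S.sum_le ?_ (fun i hi => S.Z_sq hi) ?_)
  · positivity
  · generalize C⁻¹ * c = κ at *
    generalize epsK C κ δ = ε at *
    field_simp

theorem char_final (S : Stp n p a δ C c) (τ : ℝ) :
    ‖∫ ω, Complex.exp ((τ * ∑ i ∈ Finset.range p, Ztil (diagonal a) ω i : ℝ) * Complex.I)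
        ∂(sphereLaw n p)
      - (Real.exp (-(τ ^ 2 * (∑ i ∈ Finset.range p, sv n i) / 2)) : ℂ)‖
      ≤ |τ| * (Real.sqrt (epsK C (C⁻¹ * c) δ) / (C⁻¹ * c))
        + errK C (C⁻¹ * c) τ * (Real.sqrt n / n) := by
  have hκ := S.κ0
  have hn := S.n0
  have hε := S.eps0
  have hC := S.C0
  have h1 := S.char_tel τ p le_rfl
  have hgK := gK_nonneg
  have h1' : (p:ℝ) * (errK C (C⁻¹ * c) τ * (Real.sqrt n / n ^ 2))
      ≤ errK C (C⁻¹ * c) τ * (Real.sqrt n / n) := by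
    have hpn : (p:ℝ) ≤ n := by exact_mod_cast S.hp
    have he : 0 ≤ errK C (C⁻¹ * c) τ := by unfold errK; positivity
    calc _ ≤ (n:ℝ) * (errK C (C⁻¹ * c) τ * (Real.sqrt n / n ^ 2)) := by gcongr
      _ = _ := by generalize errK C (C⁻¹ * c) τ = e; field_simp
  have iZ : Integrable (fun ω : Fin p → Fin n → ℝ => Complex.exp ((τ * ∑ i ∈ Finset.range p,
      Ztil (diagonal a) ω i : ℝ) * Complex.I)) (sphereLaw n p) := by
    refine int_bdd ?_ 1 fun ω => ?_
    · have : Measurable fun ω : Fin p → Fin n → ℝ => τ * ∑ i ∈ Finset.range p,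
          Ztil (diagonal a) ω i :=
        (Finset.measurable_sum _ fun i hi => S.Z_meas (Finset.mem_range.1 hi).le).const_mul _
      exact (Complex.measurable_exp.comp
        ((Complex.measurable_ofReal.comp this).mul_const _)).aestronglyMeasurable
    · rw [Complex.norm_exp_ofReal_mul_I]
  have h2 : ‖∫ ω, Complex.exp ((τ * ∑ i ∈ Finset.range p, Ztil (diagonal a) ω i : ℝ) * Complex.I)
        ∂(sphereLaw n p) - ∫ ω, Complex.exp ((τ * ∑ i ∈ Finset.range p, Wd a ω i : ℝ) * Complex.I)
        ∂(sphereLaw n p)‖ ≤ |τ| * (Real.sqrt (epsK C (C⁻¹ * c) δ) / (C⁻¹ * c)) := by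
    rw [← integral_sub iZ (char_int τ p)]
    have hi : Integrable (fun ω : Fin p → Fin n → ℝ => |τ| * ∑ i ∈ Finset.range p, |Rd a ω i|)
        (sphereLaw n p) := 
      (integrable_finsetSum _ fun i hi => (S.R_int (Finset.mem_range.1 hi).le).abs).const_mul _
    refine (norm_integral_le_of_norm_le hi (ae_of_all _ fun ω => ?_)).trans ?_
    · refine (exp_lip _ _).trans ?_
      rw [← mul_sub, abs_mul, ← Finset.sum_sub_distrib]
      gcongr
      refine (Finset.abs_sum_le_sum_abs _ _).trans (le_of_eq (Finset.sum_congr rfl fun i hi => ?_))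
      rw [S.Z_split (Finset.mem_range.1 hi).le, add_sub_cancel_left]
    · rw [integral_const_mul, integral_finsetSum _ fun i hi =>
        (S.R_int (Finset.mem_range.1 hi).le).abs]
      gcongr
      refine S.sum_le ?_ (fun i hi => S.R_abs hi.le) ?_
      · positivity
      · generalize Real.sqrt (epsK C (C⁻¹ * c) δ) = e
        generalize C⁻¹ * c = κ at *
        field_simp
  calc _ ≤ _ := norm_sub_le_norm_sub_add_norm_sub _ (∫ ω, Complex.exp ((τ * ∑ i ∈ Finset.range p,
        Wd a ω i : ℝ) * Complex.I) ∂(sphereLaw n p)) _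
    _ ≤ _ := add_le_add h2 (h1.trans h1')

theorem sv_sum_ge (S : Stp n p a δ C c) : (p:ℝ) / n * (p / n) - p / n * (1 / n) ≤ ∑ i ∈ Finset.range p, sv n i := by
  have hn := S.n0
  have h1 : ∀ i ∈ Finset.range p, 2 * (i:ℝ) / n ^ 2 ≤ sv n i := by
    intro i hi
    have hi' := (Finset.mem_range.1 hi).le
    have h2 : 0 < (n:ℝ) - i := lt_of_lt_of_le (mul_pos S.κ0 S.n0) (S.κle hi')
    have h3 : (0:ℝ) ≤ i := Nat.cast_nonneg i
    have : sv n i = 2 * i / (n * (n - i)) := by unfold sv; field_simp; ring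
    rw [this]
    gcongr
    nlinarith
  refine le_trans (le_of_eq ?_) (Finset.sum_le_sum h1)
  rw [← Finset.sum_div, ← Finset.mul_sum]
  have : ∀ q : ℕ, 2 * ∑ i ∈ Finset.range q, (i:ℝ) = q * (q - 1) := by
    intro q
    induction q with
    | zero => simp
    | succ q ih => rw [Finset.sum_range_succ, mul_add, ih]; push_cast; ring
  rw [this]
  field_simp

end Stp

open MeasureTheory ProbabilityTheory Matrix Filter Topology

theorem levy_real {Ω : ℕ → Type} [∀ n, MeasurableSpace (Ω n)] (μ : ∀ n, Measure (Ω n))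
    [∀ n, IsProbabilityMeasure (μ n)] (X : ∀ n, Ω n → ℝ)
    (hX : ∀ᶠ n in atTop, Measurable (X n))
    (h : ∀ t : ℝ, Tendsto (fun n => ∫ ω, Complex.exp ((t * X n ω : ℝ) * Complex.I) ∂(μ n)) atTop
      (𝓝 (Real.exp (-(t ^ 2 / 2)) : ℂ))) (f : BoundedContinuousFunction ℝ ℝ) :
    Tendsto (fun n => ∫ ω, f (X n ω) ∂(μ n)) atTop (𝓝 (∫ x, f x ∂(gaussianReal 0 1))) := by
  classical
  let Y : ∀ n, Ω n → ℝ := fun n => if Measurable (X n) then X n else fun _ => 0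
  have hY : ∀ n, Measurable (Y n) := by
    intro n
    by_cases hn : Measurable (X n)
    · simp only [Y, hn, if_true]
    · simp only [Y, hn, if_false]; exact measurable_const
  have hYX : ∀ᶠ n in atTop, Y n = X n := by
    filter_upwards [hX] with n hn
    simp only [Y, hn, if_true]
  let ν : ℕ → ProbabilityMeasure ℝ := fun n =>
    ⟨(μ n).map (Y n), Measure.isProbabilityMeasure_map (hY n).aemeasurable⟩
  let ν0 : ProbabilityMeasure ℝ := ⟨gaussianReal 0 1, inferInstance⟩
  have key : Tendsto ν atTop (𝓝 ν0) := by
    refine ProbabilityMeasure.tendsto_of_tendsto_charFun fun t => ?_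
    have e0 : charFun (ν0 : Measure ℝ) t = (Real.exp (-(t ^ 2 / 2)) : ℂ) := by
      show charFun (gaussianReal 0 1) t = _
      rw [charFun_gaussianReal]
      push_cast
      congr 1
      simp
    rw [e0]
    refine (h t).congr' ?_
    filter_upwards [hYX] with n hn
    show _ = charFun ((μ n).map (Y n)) t
    rw [charFun_apply_real, integral_map (hY n).aemeasurable]
    · rw [hn]
      push_cast
      rfl
    · exact (Continuous.aestronglyMeasurable (by fun_prop))
  have h2 := (ProbabilityMeasure.tendsto_iff_forall_integral_tendsto.1 key) f
  refine h2.congr' ?_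
  filter_upwards [hYX] with n hn
  show ∫ x, f x ∂((μ n).map (Y n)) = _
  rw [integral_map (hY n).aemeasurable f.continuous.aestronglyMeasurable, hn]

theorem errK_mono {C κ τ K : ℝ} (hκ : 0 < κ) (h : |τ| ≤ K) : errK C κ τ ≤ errK C κ K := by
  have hK : 0 ≤ K := (abs_nonneg _).trans h
  have hg := gK_nonneg
  have h2 : τ ^ 2 ≤ K ^ 2 := by rw [← sq_abs τ]; gcongr
  have h4 : τ ^ 4 ≤ K ^ 4 := by
    have : τ ^ 4 = |τ| ^ 4 := by rw [pow_abs, abs_of_nonneg (by positivity)]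
    rw [this]; gcongr
  rw [errK, errK, abs_of_nonneg hK]
  have hC4 : 0 ≤ 16 * gK * C ^ 4 := by positivity
  gcongr

theorem sqrt_div_tendsto : Tendsto (fun n : ℕ => Real.sqrt n / (n:ℝ)) atTop (𝓝 0) := by
  have h1 : Tendsto (fun n : ℕ => (Real.sqrt n)⁻¹) atTop (𝓝 0) :=
    (Real.tendsto_sqrt_atTop.comp tendsto_natCast_atTop_atTop).inv_tendsto_atTop
  refine h1.congr fun n => ?_
  rw [Real.sqrt_div_self]

theorem clt_diag (p : ℕ → ℕ) (γ : ℝ) (a : ∀ n, Fin n → ℝ) (δ : ℕ → ℝ) (C c : ℝ)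
    (hγ : 0 < γ) (hC : 1 ≤ C) (hc : 0 < c)
    (hA : Tendsto (fun n => (p n : ℝ) / (n : ℝ)) atTop (𝓝 γ))
    (hδ : Tendsto δ atTop (𝓝 0))
    (hS : ∀ᶠ n in atTop, Stp n (p n) (a n) (δ n) C c) (f : BoundedContinuousFunction ℝ ℝ) :
      Tendsto (fun n => ∫ ω,
          f ((∑ i ∈ Finset.range (p n), Ztil (diagonal (a n)) ω i) /
            Real.sqrt (∑ i ∈ Finset.range (p n),
              ∫ ω', (Ztil (diagonal (a n)) ω' i) ^ 2 ∂(sphereLaw n (p n))))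
          ∂(sphereLaw n (p n)))
        atTop (𝓝 (∫ x, f x ∂(gaussianReal 0 1))) := by
  set σ : ℕ → ℝ := fun n => ∑ i ∈ Finset.range (p n),
              ∫ ω', (Ztil (diagonal (a n)) ω' i) ^ 2 ∂(sphereLaw n (p n)) with hσ
  set s : ℕ → ℝ := fun n => ∑ i ∈ Finset.range (p n), sv n i with hs
  set κ := C⁻¹ * c with hκd
  have hκ : 0 < κ := by positivity
  have heps : Tendsto (fun n => epsK C κ (δ n)) atTop (𝓝 0) := by
    have : Continuous fun x => epsK C κ x := by unfold epsK; fun_prop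
    have h := (this.tendsto 0).comp hδ
    simpa [epsK, Function.comp_def] using h
  have hn1 : Tendsto (fun n : ℕ => 1 / (n:ℝ)) atTop (𝓝 0) := tendsto_one_div_atTop_nhds_zero_nat
  have hsq := sqrt_div_tendsto
  have hd : Tendsto (fun n => |σ n - s n|) atTop (𝓝 0) := by
    have hb : Tendsto (fun n : ℕ => (20 / κ ^ 2 + 6 / κ ^ 3) * (Real.sqrt n / n)
        + epsK C κ (δ n) / κ ^ 2 * (1 / n)) atTop (𝓝 0) := by
      have := (hsq.const_mul (20 / κ ^ 2 + 6 / κ ^ 3)).add ((heps.div_const (κ ^ 2)).mul hn1)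
      simpa using this
    refine tendsto_of_tendsto_of_tendsto_of_le_of_le' tendsto_const_nhds hb
      (Eventually.of_forall fun n => abs_nonneg _) ?_
    filter_upwards [hS] with n S
    exact S.sigma_close
  have hσlow : ∀ᶠ n in atTop, γ ^ 2 / 2 ≤ σ n := by
    have h1 : Tendsto (fun n : ℕ => (p n:ℝ) / n * (p n / n) - p n / n * (1 / n)) atTop
        (𝓝 (γ * γ - γ * 0)) := (hA.mul hA).sub (hA.mul hn1)
    have h2 : ∀ᶠ n : ℕ in atTop, 3 * γ ^ 2 / 4 < (p n:ℝ) / n * (p n / n) - p n / n * (1 / n) :=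
      h1.eventually (lt_mem_nhds (by nlinarith))
    have h3 : ∀ᶠ n in atTop, |σ n - s n| < γ ^ 2 / 4 := hd.eventually (gt_mem_nhds (by positivity))
    filter_upwards [hS, h2, h3] with n S h2 h3
    have h4 := S.sv_sum_ge
    have h5 := (abs_lt.1 h3).1
    have h6 : s n = ∑ i ∈ Finset.range (p n), sv n i := rfl
    linarith
  have hv : 0 < γ ^ 2 / 2 := by positivity
  have hratio : Tendsto (fun n => s n / σ n) atTop (𝓝 1) := by
    rw [tendsto_iff_dist_tendsto_zero]
    have hb : Tendsto (fun n => |σ n - s n| / (γ ^ 2 / 2)) atTop (𝓝 0) := by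
      simpa using hd.div_const (γ ^ 2 / 2)
    refine tendsto_of_tendsto_of_tendsto_of_le_of_le' tendsto_const_nhds hb
      (Eventually.of_forall fun n => dist_nonneg) ?_
    filter_upwards [hσlow] with n hn
    have h0 : 0 < σ n := hv.trans_le hn
    rw [Real.dist_eq, div_sub_one h0.ne', abs_div, abs_of_pos h0, abs_sub_comm]
    gcongr
  refine levy_real (fun n => sphereLaw n (p n)) _ ?_ ?_ f
  · filter_upwards [hS] with n S
    exact (Finset.measurable_sum _ fun i hi => S.Z_meas (Finset.mem_range.1 hi).le).div_const _
  · intro t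
    have hexp : Tendsto (fun n => (Real.exp (-(t ^ 2 * (s n / σ n) / 2)) : ℂ)) atTop
        (𝓝 (Real.exp (-(t ^ 2 / 2)) : ℂ)) := by
      have h1 : Continuous fun x : ℝ => (Real.exp (-(t ^ 2 * x / 2)) : ℂ) := by fun_prop
      have := (h1.tendsto 1).comp hratio
      simpa [Function.comp_def] using this
    set K := |t| / Real.sqrt (γ ^ 2 / 2) with hK
    have hdiff : Tendsto (fun n => (∫ ω, Complex.exp ((t * ((∑ i ∈ Finset.range (p n),
        Ztil (diagonal (a n)) ω i) / Real.sqrt (σ n)) : ℝ) * Complex.I) ∂(sphereLaw n (p n)))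
        - (Real.exp (-(t ^ 2 * (s n / σ n) / 2)) : ℂ)) atTop (𝓝 0) := by
      rw [tendsto_zero_iff_norm_tendsto_zero]
      have hb : Tendsto (fun n : ℕ => K * (Real.sqrt (epsK C κ (δ n)) / κ)
          + errK C κ K * (Real.sqrt n / n)) atTop (𝓝 0) := by
        have h1 := (((Real.continuous_sqrt.tendsto 0).comp heps).div_const κ).const_mul K
        have := h1.add (hsq.const_mul (errK C κ K))
        simpa [Function.comp_def] using this
      refine tendsto_of_tendsto_of_tendsto_of_le_of_le' tendsto_const_nhds hb
        (Eventually.of_forall fun n => norm_nonneg _) ?_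
      filter_upwards [hS, hσlow] with n S hn
      have h0 : 0 < σ n := hv.trans_le hn
      have hτ : |t / Real.sqrt (σ n)| ≤ K := by
        rw [abs_div, abs_of_nonneg (Real.sqrt_nonneg _), hK]
        have := Real.sqrt_pos.2 hv
        gcongr
      have h1 := S.char_final (t / Real.sqrt (σ n))
      have e1 : ∀ ω : Fin (p n) → Fin n → ℝ, t * ((∑ i ∈ Finset.range (p n),
          Ztil (diagonal (a n)) ω i) / Real.sqrt (σ n))
          = t / Real.sqrt (σ n) * ∑ i ∈ Finset.range (p n), Ztil (diagonal (a n)) ω i := by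
        intro ω; ring
      have e2 : t ^ 2 * (s n / σ n) / 2 = (t / Real.sqrt (σ n)) ^ 2 * s n / 2 := by
        rw [div_pow, Real.sq_sqrt h0.le]; ring
      simp only [e1]
      rw [e2]
      refine h1.trans ?_
      have := errK_mono (C := C) hκ hτ
      gcongr
    have := hdiff.add hexp
    simpa using this

/-- Under Assumptions (A) and (B), with `σ̃_n² = ∑_{i=0}^{p−1} E[Z̃_{i+1}²]`,
the normalized sum `σ̃_n⁻¹ ∑_{i=0}^{p−1} Z̃_{i+1}` converges in distribution to `N(0,1)`. -/
theorem clt_sum_Ztil (p : ℕ → ℕ) (γ : ℝ)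
    (A : ∀ n, Matrix (Fin n) (Fin n) ℝ)
    (hp : ∀ n, p n ≤ n)
    (hdiag : ∀ n, (A n).IsDiag) (hpos : ∀ n k, 0 < A n k k)
    (htr : ∀ n, Matrix.trace (A n * A n) = (n : ℝ))
    (hγ : 0 < γ ∧ γ < 1)
    (hA : Tendsto (fun n => (p n : ℝ) / (n : ℝ)) atTop (𝓝 γ))
    (C : ℝ) (hC : 1 ≤ C)
    (hCb : ∀ n k, C⁻¹ ≤ (A n k k) ^ 2 ∧ (A n k k) ^ 2 ≤ C)
    (hB2 : Tendsto
      (fun n => Matrix.trace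
        ((A n * A n - (Matrix.trace (A n * A n) / (n : ℝ)) • (1 : Matrix (Fin n) (Fin n) ℝ)) ^ 2))
      atTop (𝓝 0)) :
    ∀ f : BoundedContinuousFunction ℝ ℝ,
      Tendsto (fun n => ∫ ω,
          f ((∑ i ∈ Finset.range (p n), Ztil (A n) ω i) /
            Real.sqrt (∑ i ∈ Finset.range (p n),
              ∫ ω', (Ztil (A n) ω' i) ^ 2 ∂(sphereLaw n (p n))))
          ∂(sphereLaw n (p n)))
        atTop (𝓝 (∫ x, f x ∂(gaussianReal 0 1))) := by
  intro f
  set a : ∀ n, Fin n → ℝ := fun n k => A n k k with ha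
  have hAd : ∀ n, A n = diagonal (a n) := fun n => (hdiag n).diagonal_diag.symm
  set D : ℕ → ℝ := fun n => ∑ k, dv (a n) k ^ 2 with hD
  have hsum : ∀ n, ∑ k, a n k ^ 2 = n := by
    intro n
    rw [← htr n, hAd n, diagonal_mul_diagonal, trace_diagonal]
    exact Finset.sum_congr rfl fun k _ => by ring
  have hDt : Tendsto D atTop (𝓝 0) := by
    refine hB2.congr' ?_
    filter_upwards [eventually_gt_atTop 0] with n hn
    have hn' : (n:ℝ) ≠ 0 := by positivity
    rw [htr n, div_self hn', one_smul, hAd n, diagonal_mul_diagonal, ← diagonal_one,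
      diagonal_sub, diagonal_pow, trace_diagonal]
    refine Finset.sum_congr rfl fun k _ => ?_
    simp only [dv, Pi.pow_apply]
    ring
  have hD0 : ∀ n, 0 ≤ D n := fun n => Finset.sum_nonneg fun k _ => sq_nonneg _
  set δ : ℕ → ℝ := fun n => Real.sqrt (D n) + 1 / n with hδd
  have hδt : Tendsto δ atTop (𝓝 0) := by
    have h1 := (Real.continuous_sqrt.tendsto 0).comp hDt
    have := h1.add (tendsto_one_div_atTop_nhds_zero_nat (𝕜 := ℝ))
    simpa [Function.comp_def, hδd] using this
  have hc : 0 < (1 - γ) / 2 := by linarith [hγ.2]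
  have hS : ∀ᶠ n in atTop, Stp n (p n) (a n) (δ n) C ((1 - γ) / 2) := by
    have h1 : ∀ᶠ n in atTop, δ n < 1 := hδt.eventually (gt_mem_nhds one_pos)
    have h2 : ∀ᶠ n in atTop, (p n : ℝ) / n < (1 + γ) / 2 :=
      hA.eventually (gt_mem_nhds (by linarith [hγ.2]))
    filter_upwards [eventually_gt_atTop 0, h1, h2] with n hn h1 h2
    have hn' : (0:ℝ) < n := by positivity
    have hq := Real.sqrt_nonneg (D n)
    have hi : (0:ℝ) < 1 / n := by positivity
    refine ⟨hn, hp n, by simp only [hδd]; positivity, h1.le, ?_, ?_, hC, hCb n, hc, ?_⟩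
    · calc D n = Real.sqrt (D n) ^ 2 := (Real.sq_sqrt (hD0 n)).symm
        _ ≤ δ n ^ 2 := by
          apply pow_le_pow_left₀ hq
          simp only [hδd]; linarith
    · simp only [dv, Finset.sum_sub_distrib, hsum n]
      simp
    · rw [div_lt_iff₀ hn'] at h2
      nlinarith
  have := clt_diag p γ a δ C ((1 - γ) / 2) hγ.1 hC hc hA hδt hS f
  simpa only [← hAd] using this
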